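/- For every ε > 0, the bound ∫_T^{2T} J_1(t,G)^m dt ≪_ε T^{1+ε} holds for m = 1 and m = 2, uniformly for all G with T^ε ≤ G ≤ T (where T ≥ 2). -/

import Mathlib

open Real MeasureTheory

/-- The smoothed moment `J_k(t,G) = (1/(√π G)) ∫_ℝ |ζ(1/2+it+iu)|^{2k} e^{-(u/G)²} du`. -/
noncomputable def J (k : ℕ) (t G : ℝ) : ℝ :=
  (1 / (Real.sqrt Real.pi * G)) *
    ∫ u : ℝ, ‖riemannZeta (1 / 2 + Complex.I * (t : ℂ) + Complex.I * (u : ℂ))‖ ^ (2 * k) *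
      Real.exp (-(u / G) ^ 2)


section PartOne
open scoped FourierTransform ComplexConjugate

lemma aux_conj_fourier (v : ℝ → ℂ) (ξ : ℝ) :
    conj (𝓕 v ξ) = 𝓕⁻ (fun u => conj (v u)) ξ := by
  rw [Real.fourier_eq', Real.fourierInv_eq', ← integral_conj]
  congr 1
  ext u
  simp [← Complex.exp_conj, Complex.conj_ofNat]

lemma aux_conj_fourier' (v : ℝ → ℂ) (ξ : ℝ) :
    𝓕 (fun u => conj (v u)) ξ = conj (𝓕⁻ v ξ) := by
  rw [Real.fourier_eq', Real.fourierInv_eq', ← integral_conj]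
  congr 1
  ext u
  simp [← Complex.exp_conj, Complex.conj_ofNat]

lemma aux_conj_fourier_neg (v : ℝ → ℂ) (ξ : ℝ) :
    𝓕 (fun u => conj (v (-u))) ξ = conj (𝓕 v ξ) := by
  rw [Real.fourier_eq', Real.fourier_eq', ← integral_conj,
    ← integral_neg_eq_self]
  congr 1
  ext u
  simp [← Complex.exp_conj, Complex.conj_ofNat]

lemma aux_plancherel (v : ℝ → ℂ) (hc : Continuous v) (hv : Integrable v)
    (hV : Integrable (𝓕 v)) : ∫ ξ, ‖𝓕 v ξ‖ ^ 2 = ∫ u, ‖v u‖ ^ 2 := by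
  have hW : Integrable (fun ξ => conj (𝓕 v ξ)) := by
    simpa using (Complex.conjCLE.toContinuousLinearMap).integrable_comp hV
  have h1 := VectorFourier.integral_fourierIntegral_smul_eq_flip (𝕜 := ℝ) (μ := volume)
    (ν := volume) (L := innerₗ ℝ) (e := Real.fourierChar) (f := v) (g := fun ξ => conj (𝓕 v ξ))
    Real.continuous_fourierChar (by exact continuous_inner) hv hW
  have h2 : ∀ u, 𝓕 (fun ξ => conj (𝓕 v ξ)) u = conj (v u) := by
    intro u
    rw [aux_conj_fourier', hc.fourierInv_fourier_eq hv hV]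
  have h3 : ∫ ξ, 𝓕 v ξ * conj (𝓕 v ξ) = ∫ u, v u * conj (v u) := by
    simp_rw [← h2]
    rw [show (innerₗ ℝ : ℝ →ₗ[ℝ] ℝ →ₗ[ℝ] ℝ).flip = innerₗ ℝ by ext; simp] at h1
    exact h1
  simp_rw [Complex.mul_conj, Complex.normSq_eq_norm_sq] at h3
  rw [integral_complex_ofReal, integral_complex_ofReal] at h3
  exact_mod_cast h3

lemma aux_exp_int (v : ℝ → ℂ) (hc : Continuous v) (hv : Integrable v) (ξ : ℝ) :
    Integrable (fun u : ℝ => Complex.exp ((↑(-2 * π * inner ℝ u ξ) * Complex.I)) • v u) := by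
  refine hv.mono (by fun_prop) (Filter.Eventually.of_forall fun u => ?_)
  rw [norm_smul, Complex.norm_exp_ofReal_mul_I, one_mul]

lemma aux_half (v : ℝ → ℂ) (hc : Continuous v) (hv : Integrable v)
    (hV : Integrable (𝓕 v)) (hv2 : Integrable (fun u => ‖v u‖ ^ 2)) (K : ℝ)
    (hK : ∫ ξ, ‖conj (𝓕 v ξ) + Complex.I * 𝓕 v ξ‖ ^ 2 ≤ K) :
    ∫ ξ, ‖𝓕 v ξ‖ ^ 2 ≤ 3 * (∫ u in Set.Iic 0, ‖v u‖ ^ 2) + 2 * K := by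
  rw [aux_plancherel v hc hv hV]
  set w : ℝ → ℂ := fun u => conj (v (-u)) with hw
  have hwi : Integrable w := by
    simpa using (Complex.conjCLE.toContinuousLinearMap).integrable_comp hv.comp_neg
  have hwc : Continuous w := Complex.continuous_conj.comp (hc.comp continuous_neg)
  set h : ℝ → ℂ := fun u => w u + Complex.I * v u with hh
  have hF : 𝓕 h = fun ξ => conj (𝓕 v ξ) + Complex.I * 𝓕 v ξ := by
    ext ξ
    rw [← aux_conj_fourier_neg, Real.fourier_eq', Real.fourier_eq', Real.fourier_eq',
      ← integral_const_mul, ← integral_add]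
    · congr 1
      ext u
      simp [hh, hw]
      ring
    · exact aux_exp_int w hwc hwi ξ
    · exact (aux_exp_int v hc hv ξ).const_mul _
  have hhi : Integrable h := hwi.add (hv.const_mul _)
  have hhc : Continuous h := hwc.add (continuous_const.mul hc)
  have hFi : Integrable (𝓕 h) := by
    rw [hF]
    have : Integrable (fun ξ => conj (𝓕 v ξ)) := by
      simpa using (Complex.conjCLE.toContinuousLinearMap).integrable_comp hV
    exact this.add (hV.const_mul _)
  have hP := aux_plancherel h hhc hhi hFi
  have hw2 : Integrable (fun u => ‖w u‖ ^ 2) := by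
    simpa [hw] using hv2.comp_neg
  have hpt : ∀ u, ‖w u‖ ^ 2 ≤ 2 * ‖h u‖ ^ 2 + 2 * ‖v u‖ ^ 2 := by
    intro u
    have h1 : ‖w u‖ ≤ ‖h u‖ + ‖v u‖ := by
      have : w u = h u - Complex.I * v u := by simp [hh]
      rw [this]
      refine (norm_sub_le _ _).trans ?_
      simp
    nlinarith [norm_nonneg (w u), norm_nonneg (h u), norm_nonneg (v u), sq_nonneg (‖h u‖ - ‖v u‖)]
  have hpt2 : ∀ u, ‖h u‖ ^ 2 ≤ 2 * ‖w u‖ ^ 2 + 2 * ‖v u‖ ^ 2 := by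
    intro u
    have h1 : ‖h u‖ ≤ ‖w u‖ + ‖v u‖ := by
      refine (norm_add_le _ _).trans ?_
      simp
    nlinarith [norm_nonneg (w u), norm_nonneg (h u), norm_nonneg (v u), sq_nonneg (‖w u‖ - ‖v u‖)]
  have hh2 : Integrable (fun u => ‖h u‖ ^ 2) := by
    refine Integrable.mono' ((hw2.const_mul 2).add (hv2.const_mul 2))
      (by fun_prop) (Filter.Eventually.of_forall fun u => ?_)
    simpa using hpt2 u
  have hsplit : ∫ u, ‖v u‖ ^ 2 = (∫ u in Set.Iic 0, ‖v u‖ ^ 2) + ∫ u in Set.Ioi 0, ‖v u‖ ^ 2 := by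
    rw [intervalIntegral.integral_Iic_add_Ioi hv2.integrableOn hv2.integrableOn]
  have hneg : ∫ u in Set.Ioi (0:ℝ), ‖v u‖ ^ 2 = ∫ u in Set.Iic (0:ℝ), ‖w u‖ ^ 2 := by
    have := integral_comp_neg_Iic (0:ℝ) (fun u => ‖v u‖ ^ 2)
    simp [hw] at this ⊢
    exact this.symm
  have hle : ∫ u in Set.Iic (0:ℝ), ‖w u‖ ^ 2 ≤
      2 * (∫ u in Set.Iic (0:ℝ), ‖h u‖ ^ 2) + 2 * ∫ u in Set.Iic (0:ℝ), ‖v u‖ ^ 2 := by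
    rw [← integral_const_mul, ← integral_const_mul, ← integral_add]
    · exact integral_mono hw2.integrableOn
        ((hh2.const_mul 2).add (hv2.const_mul 2)).integrableOn hpt
    · exact (hh2.const_mul 2).integrableOn
    · exact (hv2.const_mul 2).integrableOn
  have hle2 : ∫ u in Set.Iic (0:ℝ), ‖h u‖ ^ 2 ≤ ∫ u, ‖h u‖ ^ 2 :=
    setIntegral_le_integral hh2 (Filter.Eventually.of_forall fun u => by positivity)
  rw [← hP, hF] at hle2
  linarith
end PartOne

section PartTwo

/-- frequency -/
noncomputable def zfr (p : ℕ × ℕ) : ℝ := 2 * π * ((p.1 + 1) * (p.2 + 1))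

lemma zfr_pos (p : ℕ × ℕ) : 0 < zfr p := by unfold zfr; positivity

noncomputable def zA (z : ℂ) : ℂ :=
  ∑' p : ℕ × ℕ, (-1 : ℂ) ^ (p.1 + p.2) * Complex.exp (-(zfr p * z))

lemma zterm_norm (p : ℕ × ℕ) (z : ℂ) :
    ‖(-1 : ℂ) ^ (p.1 + p.2) * Complex.exp (-(zfr p * z))‖ = Real.exp (-(zfr p * z.re)) := by
  simp [Complex.norm_exp]

lemma zexp_le (p : ℕ × ℕ) (η : ℝ) (hη : 0 < η) (z : ℂ) (hz : η ≤ z.re) :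
    Real.exp (-(zfr p * z.re)) ≤ Real.exp (-(2 * π * η)) ^ p.1 * Real.exp (-(2 * π * η)) ^ p.2 := by
  rw [← Real.exp_nat_mul, ← Real.exp_nat_mul, ← Real.exp_add]
  apply Real.exp_le_exp.2
  unfold zfr
  have h1 : (p.1 : ℝ) + p.2 ≤ (p.1 + 1) * (p.2 + 1) := by nlinarith [Nat.cast_nonneg (α := ℝ) p.1, Nat.cast_nonneg (α := ℝ) p.2, mul_nonneg (Nat.cast_nonneg (α := ℝ) p.1) (Nat.cast_nonneg (α := ℝ) p.2)]
  have h2 : ((p.1 : ℝ) + p.2) * η ≤ ((p.1 + 1) * (p.2 + 1)) * z.re := by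
    apply mul_le_mul h1 hz hη.le (by positivity)
  nlinarith [Real.pi_pos]

lemma zgeom_summable (η : ℝ) (hη : 0 < η) :
    Summable (fun p : ℕ × ℕ => Real.exp (-(2 * π * η)) ^ p.1 * Real.exp (-(2 * π * η)) ^ p.2) := by
  have h : Real.exp (-(2 * π * η)) < 1 := by
    rw [Real.exp_lt_one_iff]; have := Real.pi_pos; nlinarith [mul_pos this hη]
  have := summable_geometric_of_lt_one (Real.exp_pos _).le h
  exact this.mul_of_nonneg this (fun n => by positivity) (fun n => by positivity)

lemma zterm_summable (z : ℂ) (hz : 0 < z.re) :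
    Summable (fun p : ℕ × ℕ => (-1 : ℂ) ^ (p.1 + p.2) * Complex.exp (-(zfr p * z))) := by
  refine Summable.of_norm_bounded (zgeom_summable z.re hz) fun p => ?_
  rw [zterm_norm]
  exact zexp_le p z.re hz z le_rfl

lemma zA_continuousOn : ContinuousOn zA {z | 0 < z.re} := by
  intro z hz
  have hz' : 0 < z.re := hz
  have hop : IsOpen {w : ℂ | z.re / 2 < w.re} := isOpen_lt continuous_const Complex.continuous_re
  have : ContinuousOn zA {w : ℂ | z.re / 2 < w.re} := by
    unfold zA
    refine continuousOn_tsum (fun p => by fun_prop) (zgeom_summable (z.re/2) (by linarith)) ?_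
    intro p w hw
    rw [zterm_norm]
    exact zexp_le p _ (by linarith) w (le_of_lt hw)
  exact (this.continuousAt (hop.mem_nhds (by show z.re / 2 < z.re; linarith))).continuousWithinAt

noncomputable def zq (w : ℂ) : ℂ := Complex.exp (-(2 * π * w)) / (1 + Complex.exp (-(2 * π * w)))

lemma zA_eq (z : ℂ) (hz : 0 < z.re) :
    HasSum (fun m : ℕ => (-1 : ℂ) ^ m * zq ((m + 1) * z)) (zA z) := by
  have h1 := (zterm_summable z hz).hasSum
  refine h1.prod_fiberwise fun m => ?_
  set y := Complex.exp (-(2 * π * ((m + 1) * z))) with hy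
  have hy1 : ‖-y‖ < 1 := by
    rw [norm_neg, hy, Complex.norm_exp, Real.exp_lt_one_iff]
    have : (-(2 * π * ((m + 1) * z)) : ℂ).re = -(2 * π * ((m + 1) * z.re)) := by
      have : (-(2 * π * ((m + 1) * z)) : ℂ) = ((-(2 * π * (m + 1)) : ℝ) : ℂ) * z := by push_cast; ring
      rw [this, Complex.re_ofReal_mul]; ring
    rw [this]
    have : 0 < 2 * π * ((m + 1) * z.re) := by have := Real.pi_pos; positivity
    linarith
  have h2 := (hasSum_geometric_of_norm_lt_one hy1).mul_left ((-1 : ℂ) ^ m * y)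
  have e1 : (-1 : ℂ) ^ m * zq ((m + 1) * z) = (-1) ^ m * y * (1 - -y)⁻¹ := by
    unfold zq
    rw [← hy, sub_neg_eq_add, div_eq_mul_inv]; ring
  rw [e1]
  refine h2.congr_fun ?_ |> id
  intro n
  have : Complex.exp (-(zfr (m, n) * z)) = y ^ (n + 1) := by
    rw [hy, ← Complex.exp_nat_mul]
    congr 1
    simp [zfr]; ring
  simp only [this]
  rw [pow_add, neg_pow y n]; ring

lemma zden_lower (c : ℂ) (hc : 0 < c.re) :
    ∃ κ : ℝ, 0 < κ ∧ ∀ x : ℝ, 0 ≤ x → κ ≤ ‖1 + Complex.exp (-(2 * π * (x * c)))‖ := by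
  have hnorm : ∀ x : ℝ, ‖Complex.exp (-(2 * π * (x * c)))‖ = Real.exp (-(2 * π * c.re * x)) := by
    intro x
    rw [Complex.norm_exp]
    congr 1
    have : (-(2 * π * (x * c)) : ℂ) = ((-(2 * π * x) : ℝ) : ℂ) * c := by push_cast; ring
    rw [this, Complex.re_ofReal_mul]; ring
  have hpc : 0 < 2 * π * c.re := by have := Real.pi_pos; positivity
  have hcont : Continuous (fun x : ℝ => ‖1 + Complex.exp (-(2 * π * (x * c)))‖) := by fun_prop
  set X : ℝ := Real.log 2 / (2 * π * c.re)
  have hX : 0 ≤ X := by have := Real.log_pos (x := 2) (by norm_num); positivity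
  obtain ⟨x0, hx0, hmin⟩ := (isCompact_Icc (a := (0:ℝ)) (b := X)).exists_isMinOn
    (Set.nonempty_Icc.2 hX) hcont.continuousOn
  have hx0p : 0 < ‖1 + Complex.exp (-(2 * π * (x0 * c)))‖ := by
    rw [norm_pos_iff]
    intro h
    have h1 : Complex.exp (-(2 * π * (x0 * c))) = -1 := by linear_combination h
    have h2 := hnorm x0
    rw [h1] at h2
    rw [norm_neg, norm_one] at h2
    have h3 := Real.exp_eq_one_iff _ |>.1 h2.symm
    have h4 : x0 = 0 := by
      rcases mul_eq_zero.1 (neg_eq_zero.1 h3) with h5 | h5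
      · exact absurd h5 hpc.ne'
      · exact h5
    rw [h4] at h1
    simp at h1
    norm_num at h1
  refine ⟨min (1/2) ‖1 + Complex.exp (-(2 * π * (x0 * c)))‖, by positivity, fun x hx => ?_⟩
  rcases le_or_gt x X with h | h
  · exact (min_le_right _ _).trans (hmin ⟨hx, h⟩)
  · refine (min_le_left _ _).trans ?_
    have h1 : Real.exp (-(2 * π * c.re * x)) ≤ 1 / 2 := by
      have : Real.log 2 ≤ 2 * π * c.re * x := by
        have := (div_lt_iff₀ hpc).1 h
        linarith
      calc Real.exp (-(2 * π * c.re * x)) ≤ Real.exp (-Real.log 2) := Real.exp_le_exp.2 (by linarith)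
        _ = 1 / 2 := by rw [Real.exp_neg, Real.exp_log (by norm_num)]; norm_num
    have h2 := norm_sub_le (1 + Complex.exp (-(2 * π * (x * c)))) (Complex.exp (-(2 * π * (x * c))))
    rw [add_sub_cancel_right, hnorm, norm_one] at h2
    linarith

lemma zq_deriv (c : ℂ) (x : ℝ) (h : 1 + Complex.exp (-(2 * π * (x * c))) ≠ 0) :
    HasDerivAt (fun x : ℝ => zq (x * c))
      (-(2 * π * c) * Complex.exp (-(2 * π * (x * c))) / (1 + Complex.exp (-(2 * π * (x * c)))) ^ 2) x := by
  have h0 : HasDerivAt (fun x : ℝ => (x : ℂ)) 1 x := Complex.ofRealCLM.hasDerivAt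
  have h1 : HasDerivAt (fun x : ℝ => Complex.exp (-(2 * π * (x * c))))
      (Complex.exp (-(2 * π * (x * c))) * (-(2 * π * (1 * c)))) x :=
    (((h0.mul_const c).const_mul (2 * π : ℂ)).neg).cexp
  have h2 := h1.div (h1.const_add 1) h
  exact h2.congr_deriv (by congr 1; ring)

lemma zq_diff (c : ℂ) (hc : 0 < c.re) :
    ∃ C : ℝ, 0 < C ∧ ∀ x y : ℝ, 0 ≤ x → x ≤ y → ‖zq (y * c) - zq (x * c)‖ ≤
      C * Real.exp (-(2 * π * c.re * x)) * (y - x) := by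
  obtain ⟨κ, hκ, hk⟩ := zden_lower c hc
  have hcn : 0 < ‖c‖ := by rw [norm_pos_iff]; rintro rfl; simp at hc
  refine ⟨2 * π * ‖c‖ / κ ^ 2, by positivity, fun x y hx hxy => ?_⟩
  have hpc : 0 < 2 * π * c.re := by have := Real.pi_pos; positivity
  have := Convex.norm_image_sub_le_of_norm_hasDerivWithin_le (f := fun x : ℝ => zq (x * c))
    (s := Set.Icc x y) (C := 2 * π * ‖c‖ / κ ^ 2 * Real.exp (-(2 * π * c.re * x)))
    (f' := fun x => -(2 * π * c) * Complex.exp (-(2 * π * (x * c))) / (1 + Complex.exp (-(2 * π * (x * c)))) ^ 2)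
    (x := x) (y := y)
    (fun u hu => (zq_deriv c u (norm_pos_iff.1 (hκ.trans_le (hk u (hx.trans hu.1))))).hasDerivWithinAt)
    ?_ (convex_Icc x y) ⟨le_rfl, hxy⟩ ⟨hxy, le_rfl⟩
  · rwa [Real.norm_eq_abs, abs_of_nonneg (by linarith : 0 ≤ y - x)] at this
  · intro u hu
    have hu0 := hx.trans hu.1
    have hnorm : ‖Complex.exp (-(2 * π * (u * c)))‖ = Real.exp (-(2 * π * c.re * u)) := by
      rw [Complex.norm_exp]
      congr 1
      have : (-(2 * π * (u * c)) : ℂ) = ((-(2 * π * u) : ℝ) : ℂ) * c := by push_cast; ring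
      rw [this, Complex.re_ofReal_mul]; ring
    rw [norm_div, norm_mul, norm_pow, hnorm, norm_neg, norm_mul, norm_mul]
    simp only [Complex.norm_ofNat, Complex.norm_real, Real.norm_eq_abs, abs_of_pos Real.pi_pos]
    rw [div_mul_eq_mul_div]
    apply div_le_div₀ (by positivity)
    · apply mul_le_mul_of_nonneg_left _ (by positivity)
      apply Real.exp_le_exp.2
      nlinarith [hu.1]
    · positivity
    · exact pow_le_pow_left₀ hκ.le (hk u hu0) 2

lemma zreal_ineq (C a x : ℝ) (hC : 0 < C) (hpc : 0 < a) (hx : 0 < x) :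
    C * x * Real.exp (-(a * x)) * (1 - Real.exp (-(2 * a * x)))⁻¹ ≤ C / a * Real.exp (-(a * x / 2)) := by
  obtain ⟨y, hyd⟩ : ∃ y, y = a * x := ⟨_, rfl⟩
  have hy : 0 < y := by rw [hyd]; positivity
  have hxy : x = y / a := by rw [hyd]; field_simp
  have hay : a * x = y := hyd.symm
  have e0 : 2 * a * x = 2 * y := by rw [hyd]; ring
  rw [e0, hay, hxy]
  have e2 : Real.exp (-y) = Real.exp (-(y/2)) * Real.exp (-(y/2)) := by rw [← Real.exp_add]; ring_nf
  have e3 : Real.exp (-(2 * y)) = Real.exp (-y) * Real.exp (-y) := by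
    rw [← Real.exp_add]; ring_nf
  have h1 : Real.exp (-y) < 1 := Real.exp_lt_one_iff.2 (by linarith)
  have h3 : y / 2 ≤ Real.sinh (y / 2) := Real.self_le_sinh_iff.2 (by positivity)
  rw [Real.sinh_eq] at h3
  have h4 : y * Real.exp (-(y/2)) ≤ 1 - Real.exp (-y) := by
    have h5 : Real.exp (y/2) * Real.exp (-(y/2)) = 1 := by rw [← Real.exp_add]; simp
    rw [e2]
    nlinarith [Real.exp_pos (-(y/2))]
  have h6 : y * Real.exp (-(y/2)) ≤ 1 - Real.exp (-(2 * y)) := by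
    rw [e3]
    nlinarith [Real.exp_pos (-y)]
  have h7 : 0 < 1 - Real.exp (-(2 * y)) := by
    rw [e3]
    nlinarith [Real.exp_pos (-y)]
  rw [← div_eq_mul_inv, div_le_iff₀ h7]
  have : C * (y / a) * Real.exp (-y) = C / a * Real.exp (-(y/2)) * (y * Real.exp (-(y/2))) := by
    rw [e2]; ring
  rw [this]
  exact mul_le_mul_of_nonneg_left h6 (by positivity)

lemma zpair_bound (c : ℂ) (C a x : ℝ) (hx : 0 < x)
    (h : ∀ x y : ℝ, 0 ≤ x → x ≤ y → ‖zq (y * c) - zq (x * c)‖ ≤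
      C * Real.exp (-(a * x)) * (y - x)) (k : ℕ) :
    ‖(-1 : ℂ) ^ (2 * k) * zq (((2 * k : ℕ) + 1) * (x * c)) +
      (-1 : ℂ) ^ (2 * k + 1) * zq (((2 * k + 1 : ℕ) + 1) * (x * c))‖ ≤
      C * x * Real.exp (-(a * x)) * Real.exp (-(2 * a * x)) ^ k := by
  have h0 : (0:ℝ) ≤ ((2 * k : ℕ) + 1) * x := by positivity
  have h1 := h (((2 * k : ℕ) + 1) * x) (((2 * k + 1 : ℕ) + 1) * x) h0 (by push_cast; nlinarith)
  rw [norm_sub_rev] at h1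
  have e : (-1 : ℂ) ^ (2 * k) * zq (((2 * k : ℕ) + 1) * (x * c)) +
      (-1 : ℂ) ^ (2 * k + 1) * zq (((2 * k + 1 : ℕ) + 1) * (x * c))
      = zq (((((2 * k : ℕ) + 1) * x : ℝ) : ℂ) * c) - zq (((((2 * k + 1 : ℕ) + 1) * x : ℝ) : ℂ) * c) := by
    rw [pow_succ, pow_mul, neg_one_sq, one_pow]
    push_cast
    simp only [one_mul, mul_assoc]
    ring
  rw [e]
  refine h1.trans (le_of_eq ?_)
  rw [← Real.exp_nat_mul]
  have h2 : Real.exp (-(a * (((2 * k : ℕ) + 1) * x))) = Real.exp (-(a * x)) * Real.exp (k * -(2 * a * x)) := by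
    rw [← Real.exp_add]; push_cast; ring_nf
  rw [h2]; push_cast; ring

lemma zA_bound (c : ℂ) (hc : 0 < c.re) :
    ∃ C : ℝ, 0 < C ∧ ∀ x : ℝ, 0 < x → ‖zA (x * c)‖ ≤ C * Real.exp (-(π * c.re * x)) := by
  obtain ⟨C, hC, h⟩ := zq_diff c hc
  obtain ⟨a, ha⟩ : ∃ a, a = 2 * π * c.re := ⟨_, rfl⟩
  rw [← ha] at h
  have hpc : 0 < a := by have := Real.pi_pos; rw [ha]; positivity
  refine ⟨C / a, by positivity, fun x hx => ?_⟩
  have hz : 0 < ((x : ℂ) * c).re := by rw [Complex.re_ofReal_mul]; positivity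
  have hs := zA_eq (x * c) hz
  have hsum := hs.summable
  have he : Summable (fun k : ℕ => (-1 : ℂ) ^ (2 * k) * zq (((2 * k : ℕ) + 1) * (x * c))) :=
    hsum.comp_injective (i := fun k : ℕ => 2 * k) (fun a b h => by simpa using h)
  have ho : Summable (fun k : ℕ => (-1 : ℂ) ^ (2 * k + 1) * zq (((2 * k + 1 : ℕ) + 1) * (x * c))) :=
    hsum.comp_injective (i := fun k : ℕ => 2 * k + 1) (fun a b h => by simpa using h)
  have h1 := HasSum.even_add_odd (f := fun m : ℕ => (-1 : ℂ) ^ m * zq ((m + 1) * (x * c))) he.hasSum ho.hasSum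
  have h2 := h1.unique hs
  rw [← Summable.tsum_add he ho] at h2
  rw [← h2]
  have hr : Real.exp (-(2 * a * x)) < 1 := by
    rw [Real.exp_lt_one_iff]; nlinarith [mul_pos hpc hx]
  have hg := (hasSum_geometric_of_lt_one (Real.exp_pos _).le hr).mul_left (C * x * Real.exp (-(a * x)))
  refine (tsum_of_norm_bounded hg fun k => zpair_bound c C a x hx h k).trans ?_
  have e1 : Real.exp (-(π * c.re * x)) = Real.exp (-(a * x / 2)) := by rw [ha]; ring_nf
  rw [e1]
  exact zreal_ineq C a x hC hpc hx

end PartTwo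

section PartThree

lemma zint_aux (σ η : ℝ) (hσ : 0 < σ) (hη : 0 < η) :
    IntegrableOn (fun t : ℝ => t ^ (σ - 1) * Real.exp (-η * t)) (Set.Ioi 0) := by
  have := integrableOn_rpow_mul_exp_neg_mul_rpow (p := 1) (s := σ - 1) (b := η)
    (by linarith) one_pos hη
  simpa using this

lemma zint_norm (s r : ℂ) (t : ℝ) (ht : 0 < t) :
    ‖(t : ℂ) ^ (s - 1) * Complex.exp (-(r * t))‖ = t ^ (s.re - 1) * Real.exp (-r.re * t) := by
  rw [norm_mul, Complex.norm_cpow_eq_rpow_re_of_pos ht, Complex.norm_exp]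
  simp

lemma zint_meas (s r : ℂ) :
    AEStronglyMeasurable (fun t : ℝ => (t : ℂ) ^ (s - 1) * Complex.exp (-(r * t)))
      (volume.restrict (Set.Ioi 0)) := by
  apply ContinuousOn.aestronglyMeasurable _ measurableSet_Ioi
  intro t ht
  apply ContinuousAt.continuousWithinAt
  apply ContinuousAt.mul _ (by fun_prop)
  exact Complex.continuousAt_ofReal_cpow_const t _ (Or.inr (ne_of_gt ht))

lemma zint_cint (s r : ℂ) (hs : 0 < s.re) (hr : 0 < r.re) :
    IntegrableOn (fun t : ℝ => (t : ℂ) ^ (s - 1) * Complex.exp (-(r * t))) (Set.Ioi 0) := by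
  refine Integrable.mono' (zint_aux s.re r.re hs hr) (zint_meas s r) ?_
  filter_upwards [ae_restrict_mem measurableSet_Ioi] with t ht
  rw [zint_norm s r t ht]

lemma zgamma_diff (s r : ℂ) (hs : 0 < s.re) (hr : 0 < r.re) :
    DifferentiableAt ℂ (fun r : ℂ => ∫ t : ℝ in Set.Ioi 0, (t : ℂ) ^ (s - 1) * Complex.exp (-(r * t))) r := by
  have hop : IsOpen {w : ℂ | r.re / 2 < w.re} := isOpen_lt continuous_const Complex.continuous_re
  have key := hasDerivAt_integral_of_dominated_loc_of_deriv_le (𝕜 := ℂ)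
    (μ := volume.restrict (Set.Ioi 0)) (x₀ := r)
    (F := fun (r : ℂ) (t : ℝ) => (t : ℂ) ^ (s - 1) * Complex.exp (-(r * t)))
    (F' := fun (r : ℂ) (t : ℝ) => (t : ℂ) ^ (s - 1) * (Complex.exp (-(r * t)) * (-t)))
    (bound := fun t => t ^ ((s.re + 1) - 1) * Real.exp (-(r.re/2) * t))
    (s := {w : ℂ | r.re / 2 < w.re}) (hop.mem_nhds (by show r.re / 2 < r.re; linarith))
    (Filter.Eventually.of_forall fun r => zint_meas s r) (zint_cint s r hs hr) ?_ ?_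
    (zint_aux (s.re + 1) (r.re/2) (by linarith) (by linarith)) ?_
  · exact key.2.differentiableAt
  · have := (zint_meas s r).mul (f := fun t : ℝ => (t : ℂ) ^ (s - 1) * Complex.exp (-(r * t)))
      (g := fun t : ℝ => (-t : ℂ)) (Continuous.aestronglyMeasurable (by fun_prop))
    refine this.congr (Filter.Eventually.of_forall fun t => ?_)
    simp [mul_assoc]
  · filter_upwards [ae_restrict_mem measurableSet_Ioi] with t ht w hw
    have ht : 0 < t := ht
    have hw : r.re / 2 < w.re := hw
    rw [← mul_assoc, norm_mul, zint_norm s w t ht, norm_neg, Complex.norm_real, Real.norm_eq_abs, abs_of_pos ht]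
    have : t ^ ((s.re + 1) - 1) = t ^ (s.re - 1) * t := by
      rw [show (s.re + 1) - 1 = (s.re - 1) + 1 by ring, Real.rpow_add_one ht.ne']
    rw [this]
    have h2 : Real.exp (-w.re * t) ≤ Real.exp (-(r.re/2) * t) := Real.exp_le_exp.2 (by nlinarith)
    have h3 : 0 < t ^ (s.re - 1) := Real.rpow_pos_of_pos ht _
    calc t ^ (s.re - 1) * Real.exp (-w.re * t) * t = (t ^ (s.re - 1) * t) * Real.exp (-w.re * t) := by ring
      _ ≤ _ := mul_le_mul_of_nonneg_left h2 (by positivity)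
  · refine Filter.Eventually.of_forall fun t w _ => ?_
    have h0 : HasDerivAt (fun w : ℂ => -(w * t)) (-(1 * t)) w := ((hasDerivAt_id w).mul_const (t : ℂ)).neg
    have := (h0.cexp).const_mul ((t : ℂ) ^ (s - 1))
    simpa using this

lemma zgamma_int (s r : ℂ) (hs : 0 < s.re) (hr : 0 < r.re) :
    ∫ t : ℝ in Set.Ioi 0, (t : ℂ) ^ (s - 1) * Complex.exp (-(r * t)) = r ^ (-s) * Complex.Gamma s := by
  have hop : IsOpen {w : ℂ | 0 < w.re} := isOpen_lt continuous_const Complex.continuous_re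
  have hA : AnalyticOnNhd ℂ (fun r : ℂ => ∫ t : ℝ in Set.Ioi 0, (t : ℂ) ^ (s - 1) * Complex.exp (-(r * t)))
      {w : ℂ | 0 < w.re} :=
    DifferentiableOn.analyticOnNhd (fun w hw => (zgamma_diff s w hs hw).differentiableWithinAt) hop
  have hB : AnalyticOnNhd ℂ (fun r : ℂ => r ^ (-s) * Complex.Gamma s) {w : ℂ | 0 < w.re} := by
    refine DifferentiableOn.analyticOnNhd (fun w hw => ?_) hop
    apply DifferentiableAt.differentiableWithinAt
    apply DifferentiableAt.mul_const
    exact DifferentiableAt.cpow_const differentiableAt_id (Or.inl hw)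
  have hconn : IsPreconnected {w : ℂ | 0 < w.re} := (convex_halfSpace_re_gt 0).isPreconnected
  refine hA.eqOn_of_preconnected_of_frequently_eq hB hconn (z₀ := 1) (by simp) ?_ hr
  have hreal : ∀ x : ℝ, 0 < x → (∫ t : ℝ in Set.Ioi 0, (t : ℂ) ^ (s - 1) * Complex.exp (-((x : ℂ) * t)))
      = (x : ℂ) ^ (-s) * Complex.Gamma s := by
    intro x hx
    rw [Complex.integral_cpow_mul_exp_neg_mul_Ioi hs hx, one_div,
      Complex.inv_cpow _ _ (by rw [Complex.arg_ofReal_of_nonneg hx.le]; exact Real.pi_pos.ne), Complex.cpow_neg]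
  rw [Filter.frequently_iff]
  intro U hU
  rw [mem_nhdsWithin] at hU
  obtain ⟨V, hV, h1, hVU⟩ := hU
  obtain ⟨e, he, hball⟩ := Metric.isOpen_iff.1 hV 1 h1
  refine ⟨((1 + e/2 : ℝ) : ℂ), hVU ⟨hball ?_, ?_⟩, hreal _ (by positivity)⟩
  · rw [Metric.mem_ball, dist_eq_norm]
    push_cast
    rw [add_sub_cancel_left, ← Complex.ofReal_ofNat, ← Complex.ofReal_div, Complex.norm_real, Real.norm_eq_abs, abs_of_pos (by positivity)]
    linarith
  · simp only [Set.mem_compl_iff, Set.mem_singleton_iff]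
    intro h
    have : (1 + e/2 : ℝ) = 1 := by exact_mod_cast h
    linarith

lemma zeta_alt (s : ℂ) (hs : 1 < s.re) :
    HasSum (fun n : ℕ => (-1 : ℂ) ^ n * ((n : ℂ) + 1) ^ (-s)) ((1 - 2 ^ (1 - s)) * riemannZeta s) := by
  have h0 : Summable (fun n : ℕ => ((n : ℂ) + 1) ^ (-s)) := by
    have h := Complex.summable_one_div_nat_cpow.2 hs
    have h2 := (summable_nat_add_iff 1).2 h
    refine h2.congr fun n => ?_
    rw [Complex.cpow_neg, one_div]; push_cast; rfl
  have hz : HasSum (fun n : ℕ => ((n : ℂ) + 1) ^ (-s)) (riemannZeta s) := by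
    have := h0.hasSum
    rw [zeta_eq_tsum_one_div_nat_add_one_cpow hs]
    convert this using 3 with n
    rw [Complex.cpow_neg, one_div]
  have hodd : HasSum (fun k : ℕ => (((2 * k + 1 : ℕ) : ℂ) + 1) ^ (-s)) (2 ^ (-s) * riemannZeta s) := by
    refine (hz.mul_left ((2:ℂ) ^ (-s))).congr_fun ?_ |> id
    intro k
    have := Complex.natCast_mul_natCast_cpow 2 (k + 1) (-s)
    push_cast at this ⊢
    rw [← this]; congr 1; ring
  have he : Summable (fun k : ℕ => (((2 * k : ℕ) : ℂ) + 1) ^ (-s)) :=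
    h0.comp_injective (i := fun k : ℕ => 2 * k) (fun a b h => by simpa using h)
  have h1 := HasSum.even_add_odd (f := fun n : ℕ => ((n : ℂ) + 1) ^ (-s)) he.hasSum hodd
  have h2 := h1.unique hz
  have h3 := HasSum.even_add_odd (f := fun n : ℕ => (-1 : ℂ) ^ n * ((n : ℂ) + 1) ^ (-s))
    (m := ∑' k : ℕ, (((2 * k : ℕ) : ℂ) + 1) ^ (-s)) (m' := -(2 ^ (-s) * riemannZeta s)) ?_ ?_
  · convert h3 using 1
    have : (2 : ℂ) ^ (1 - s) = 2 * 2 ^ (-s) := by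
      rw [sub_eq_add_neg, Complex.cpow_add _ _ (by norm_num), Complex.cpow_one]
    rw [this]
    linear_combination -h2
  · simpa [pow_mul] using he.hasSum
  · simpa [pow_mul, pow_succ] using hodd.neg

end PartThree

section PartFour

lemma zcpow_split (a : ℝ) (ha : 0 < a) (c : ℂ) (hc : c ≠ 0) (s : ℂ) :
    ((a : ℂ) * c) ^ s = (a : ℂ) ^ s * c ^ s := by
  have ha' : (a : ℂ) ≠ 0 := by exact_mod_cast ha.ne'
  rw [Complex.cpow_def_of_ne_zero (mul_ne_zero ha' hc), Complex.cpow_def_of_ne_zero ha',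
    Complex.cpow_def_of_ne_zero hc, ← Complex.exp_add, Complex.log_ofReal_mul ha hc, Complex.ofReal_log ha.le]
  congr 1; ring

lemma zfr_cpow (p : ℕ × ℕ) (s : ℂ) :
    (zfr p : ℂ) ^ s = (2 * π : ℂ) ^ s * (((p.1 : ℂ) + 1) ^ s * ((p.2 : ℂ) + 1) ^ s) := by
  unfold zfr
  have h1 := Complex.mul_cpow_ofReal_nonneg (a := 2 * π) (b := ((p.1 + 1) * (p.2 + 1) : ℝ)) (by positivity) (by positivity) s
  have h2 := Complex.mul_cpow_ofReal_nonneg (a := (p.1 + 1 : ℝ)) (b := (p.2 + 1 : ℝ)) (by positivity) (by positivity) s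
  push_cast at h1 h2 ⊢
  rw [h1, h2]

lemma zsq_sum (a : ℕ → ℂ) (z K : ℂ) (hz : HasSum a z) :
    HasSum (fun p : ℕ × ℕ => K * (a p.1 * a p.2)) (K * z ^ 2) := by
  have hzn : Summable (fun n : ℕ => ‖a n‖) := hz.summable.norm
  have hm : Summable (fun p : ℕ × ℕ => a p.1 * a p.2) := summable_mul_of_summable_norm hzn hzn
  rw [sq]
  exact (hz.mul hz hm).mul_left K

lemma zmellin_one (c : ℂ) (hc : 0 < c.re) (s : ℂ) (hs : 1 < s.re) :
    mellin (fun x : ℝ => zA (x * c)) s =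
      (2 * π : ℂ) ^ (-s) * c ^ (-s) * Complex.Gamma s * ((1 - 2 ^ (1 - s)) * riemannZeta s) ^ 2 := by
  have hc0 : c ≠ 0 := by rintro rfl; simp at hc
  obtain ⟨F, hF⟩ : ∃ F : ℕ × ℕ → ℝ → ℂ, F = fun (p : ℕ × ℕ) (t : ℝ) => (-1 : ℂ) ^ (p.1 + p.2) * ((t : ℂ) ^ (s - 1) * Complex.exp (-((zfr p * c) * t))) := ⟨_, rfl⟩
  have hre : ∀ p, 0 < (zfr p * c : ℂ).re := fun p => by
    rw [Complex.re_ofReal_mul]; exact mul_pos (zfr_pos p) hc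
  have hint : ∀ p, Integrable (F p) (volume.restrict (Set.Ioi 0)) := fun p => by
    rw [hF]
    exact (zint_cint s (zfr p * c) (by linarith) (hre p)).const_mul _
  have hnorm : ∀ p, ∫ t in Set.Ioi 0, ‖F p t‖ = (1 / (zfr p * c.re)) ^ s.re * Real.Gamma s.re := by
    intro p
    rw [← Real.integral_rpow_mul_exp_neg_mul_Ioi (by linarith) (mul_pos (zfr_pos p) hc)]
    refine setIntegral_congr_fun measurableSet_Ioi fun t ht => ?_
    simp only [hF]
    rw [norm_mul, zint_norm s _ t ht, Complex.re_ofReal_mul]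
    simp
  have hsum : Summable (fun p => ∫ t in Set.Ioi 0, ‖F p t‖) := by
    simp_rw [hnorm]
    apply Summable.mul_right
    have h0 : Summable (fun n : ℕ => ((n : ℝ) + 1) ^ (-s.re)) := by
      have := (summable_nat_add_iff 1).2 (Real.summable_nat_rpow.2 (by linarith : -s.re < -1))
      simpa using this
    have h1 := (h0.mul_of_nonneg h0 (fun n => by positivity) (fun n => by positivity)).mul_left
      ((2 * π * c.re) ^ (-s.re))
    refine h1.congr fun p => ?_
    rw [one_div, Real.inv_rpow (mul_pos (zfr_pos p) hc).le, ← Real.rpow_neg (mul_pos (zfr_pos p) hc).le,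
      ← Real.mul_rpow (by positivity) (by positivity), ← Real.mul_rpow (by positivity) (by positivity)]
    congr 1
    unfold zfr; ring
  have key := hasSum_integral_of_summable_integral_norm hint hsum
  have hval : ∀ p, ∫ t in Set.Ioi 0, F p t =
      ((2 * π : ℂ) ^ (-s) * c ^ (-s) * Complex.Gamma s) *
       (((-1 : ℂ) ^ p.1 * ((p.1 : ℂ) + 1) ^ (-s)) * ((-1 : ℂ) ^ p.2 * ((p.2 : ℂ) + 1) ^ (-s))) := by
    intro p
    simp only [hF]
    rw [integral_const_mul, zgamma_int s _ (by linarith) (hre p), zcpow_split _ (zfr_pos p) _ hc0, zfr_cpow, pow_add]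
    ring
  have hprod := zsq_sum _ _ ((2 * π : ℂ) ^ (-s) * c ^ (-s) * Complex.Gamma s) (zeta_alt s hs)
  rw [funext hval] at key
  have e := key.unique hprod
  rw [← e]
  unfold mellin
  refine setIntegral_congr_fun measurableSet_Ioi fun t ht => ?_
  simp only [hF, zA, smul_eq_mul, ← tsum_mul_left]
  refine tsum_congr fun p => ?_
  have : (zfr p * c * t : ℂ) = zfr p * (t * c) := by ring
  rw [this]; ring

lemma zA_ray_cont (c : ℂ) (hc : 0 < c.re) : ContinuousOn (fun x : ℝ => zA (x * c)) (Set.Ioi 0) := by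
  refine zA_continuousOn.comp (by fun_prop) ?_
  intro x hx
  show 0 < ((x : ℂ) * c).re
  rw [Complex.re_ofReal_mul]; exact mul_pos hx hc

lemma zA_ray_top (c : ℂ) (hc : 0 < c.re) :
    (fun x : ℝ => zA (x * c)) =O[Filter.atTop] fun t => Real.exp (-(π * c.re) * t) := by
  obtain ⟨C, hC, h⟩ := zA_bound c hc
  refine Asymptotics.IsBigO.of_bound C ?_
  filter_upwards [Filter.eventually_gt_atTop 0] with x hx
  have := h x hx
  rwa [Real.norm_eq_abs, abs_of_pos (Real.exp_pos _), neg_mul]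

lemma zA_ray_bot (c : ℂ) (hc : 0 < c.re) :
    (fun x : ℝ => zA (x * c)) =O[nhdsWithin 0 (Set.Ioi 0)] fun t => t ^ (-(0:ℝ)) := by
  obtain ⟨C, hC, h⟩ := zA_bound c hc
  refine Asymptotics.IsBigO.of_bound C ?_
  filter_upwards [self_mem_nhdsWithin] with x hx
  have hx : 0 < x := hx
  have := h x hx
  simp only [neg_zero, Real.rpow_zero, norm_one, mul_one]
  refine this.trans (mul_le_of_le_one_right hC.le (Real.exp_le_one_iff.2 ?_))
  have : 0 < π * c.re * x := by positivity
  linarith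

lemma zA_conv (c : ℂ) (hc : 0 < c.re) (s : ℂ) (hs : 0 < s.re) :
    MellinConvergent (fun x : ℝ => zA (x * c)) s :=
  mellinConvergent_of_isBigO_rpow_exp (a := π * c.re) (b := 0) (by positivity)
    ((zA_ray_cont c hc).locallyIntegrableOn measurableSet_Ioi) (zA_ray_top c hc) (zA_ray_bot c hc) hs

lemma zmellin_diff (c : ℂ) (hc : 0 < c.re) (s : ℂ) (hs : 0 < s.re) :
    DifferentiableAt ℂ (mellin (fun x : ℝ => zA (x * c))) s :=
  mellin_differentiableAt_of_isBigO_rpow_exp (a := π * c.re) (b := 0) (by positivity)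
    ((zA_ray_cont c hc).locallyIntegrableOn measurableSet_Ioi) (zA_ray_top c hc) (zA_ray_bot c hc) hs

lemma zmellin_two (c : ℂ) (hc : 0 < c.re) (s : ℂ) (hs : 0 < s.re) (him : s.im ≠ 0) :
    mellin (fun x : ℝ => zA (x * c)) s =
      (2 * π : ℂ) ^ (-s) * c ^ (-s) * Complex.Gamma s * ((1 - 2 ^ (1 - s)) * riemannZeta s) ^ 2 := by
  have hc0 : c ≠ 0 := by rintro rfl; simp at hc
  have main : ∀ U : Set ℂ, IsOpen U → IsPreconnected U → (∀ w ∈ U, 0 < w.re ∧ w.im ≠ 0) →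
      ∀ z₀ ∈ U, 1 < z₀.re → s ∈ U → mellin (fun x : ℝ => zA (x * c)) s =
      (2 * π : ℂ) ^ (-s) * c ^ (-s) * Complex.Gamma s * ((1 - 2 ^ (1 - s)) * riemannZeta s) ^ 2 := by
    intro U hU hconn hsub z₀ hz₀ hz₀re hsU
    have hA : AnalyticOnNhd ℂ (mellin (fun x : ℝ => zA (x * c))) U :=
      DifferentiableOn.analyticOnNhd (fun w hw => (zmellin_diff c hc w (hsub w hw).1).differentiableWithinAt) hU
    have hB : AnalyticOnNhd ℂ (fun s : ℂ => (2 * π : ℂ) ^ (-s) * c ^ (-s) * Complex.Gamma s * ((1 - 2 ^ (1 - s)) * riemannZeta s) ^ 2) U := by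
      refine DifferentiableOn.analyticOnNhd (fun w hw => ?_) hU
      apply DifferentiableAt.differentiableWithinAt
      have hw1 : w ≠ 1 := by rintro rfl; exact (hsub _ hw).2 (by simp)
      have hG : DifferentiableAt ℂ Complex.Gamma w := by
        apply Complex.differentiableAt_Gamma
        rintro m rfl
        exact (hsub _ hw).2 (by simp)
      have hzeta := differentiableAt_riemannZeta hw1
      have e1 : DifferentiableAt ℂ (fun s : ℂ => (2 * π : ℂ) ^ (-s)) w :=
        DifferentiableAt.const_cpow differentiableAt_id.neg (Or.inl (by simp [Real.pi_ne_zero]))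
      have e2 : DifferentiableAt ℂ (fun s : ℂ => c ^ (-s)) w :=
        DifferentiableAt.const_cpow differentiableAt_id.neg (Or.inl hc0)
      have e3 : DifferentiableAt ℂ (fun s : ℂ => (2 : ℂ) ^ (1 - s)) w :=
        DifferentiableAt.const_cpow (differentiableAt_id.const_sub 1) (Or.inl two_ne_zero)
      exact ((e1.mul e2).mul hG).mul (((e3.const_sub 1).mul hzeta).pow 2)
    refine hA.eqOn_of_preconnected_of_eventuallyEq hB hconn hz₀ ?_ hsU
    have hop : IsOpen {w : ℂ | 1 < w.re} := isOpen_lt continuous_const Complex.continuous_re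
    filter_upwards [hop.mem_nhds hz₀re] with w hw
    exact zmellin_one c hc w hw
  rcases lt_or_gt_of_ne him with h | h
  · refine main ({w : ℂ | 0 < w.re} ∩ {w : ℂ | w.im < 0})
      ((isOpen_lt continuous_const Complex.continuous_re).inter (isOpen_lt Complex.continuous_im continuous_const))
      ((convex_halfSpace_re_gt 0).inter (convex_halfSpace_im_lt 0)).isPreconnected
      (fun w hw => ⟨hw.1, ne_of_lt hw.2⟩) ⟨2, -1⟩ ⟨?_, ?_⟩ ?_ ⟨hs, h⟩
    all_goals simp
  · refine main ({w : ℂ | 0 < w.re} ∩ {w : ℂ | 0 < w.im})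
      ((isOpen_lt continuous_const Complex.continuous_re).inter (isOpen_lt continuous_const Complex.continuous_im))
      ((convex_halfSpace_re_gt 0).inter (convex_halfSpace_im_gt 0)).isPreconnected
      (fun w hw => ⟨hw.1, ne_of_gt hw.2⟩) ⟨2, 1⟩ ⟨?_, ?_⟩ ?_ ⟨hs, h⟩
    all_goals simp

end PartFour

section PartFive
open scoped FourierTransform ComplexConjugate

lemma zexp_abs_int (κ : ℝ) (hκ : 0 < κ) : Integrable (fun x : ℝ => Real.exp (-(κ * |x|))) := by
  rw [← integrableOn_univ, ← Set.Iic_union_Ioi (a := (0:ℝ)), integrableOn_union]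
  constructor
  · refine (integrableOn_exp_mul_Iic hκ 0).congr_fun (fun x hx => ?_) measurableSet_Iic
    have hx : x ≤ 0 := hx
    simp only [abs_of_nonpos hx]; congr 1; ring
  · refine (exp_neg_integrableOn_Ioi 0 hκ).congr_fun (fun x hx => ?_) measurableSet_Ioi
    have hx : 0 < x := hx
    simp only [abs_of_pos hx]; congr 1; ring

/-- the ray -/
noncomputable def zc (θ : ℝ) : ℂ := Complex.exp (θ * Complex.I)

lemma zc_re (θ : ℝ) : (zc θ).re = Real.cos θ := by
  unfold zc; exact Complex.exp_ofReal_mul_I_re θ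

lemma zc_pos (θ : ℝ) (h0 : 0 ≤ θ) (h1 : θ < π / 2) : 0 < (zc θ).re := by
  rw [zc_re]; exact Real.cos_pos_of_mem_Ioo ⟨by linarith [Real.pi_pos], h1⟩

noncomputable def zg (θ x : ℝ) : ℂ := zA (x * zc θ)

noncomputable def zf (θ x : ℝ) : ℂ :=
  Complex.exp (θ / 2 * Complex.I) * (zg θ x - 2 * zg θ ((1/2) * x) + zg θ ((1/4) * x))

noncomputable def zv (θ u : ℝ) : ℂ := Real.exp (-(1/2) * u) • zf θ (Real.exp (-u))

noncomputable def zs (t : ℝ) : ℂ := 1 / 2 + t * Complex.I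

lemma zs_re (t : ℝ) : (zs t).re = 1 / 2 := by simp [zs]
lemma zs_im (t : ℝ) : (zs t).im = t := by simp [zs]

noncomputable def zX (t : ℝ) : ℂ := (2 * π : ℂ) ^ (-(zs t)) * Complex.Gamma (zs t) * riemannZeta (zs t) ^ 2

noncomputable def zP (t : ℝ) : ℝ := ‖1 - (2 : ℂ) ^ (zs t)‖ ^ 4

lemma zs_conj (t : ℝ) : 1 - zs t = conj (zs t) := by
  apply Complex.ext <;> simp [zs]; norm_num

lemma zP_eq (t : ℝ) : (1 - (2:ℂ) ^ (1 - zs t)) ^ 2 * (1 - (2:ℂ) ^ (zs t)) ^ 2 = zP t := by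
  have h : (1 - (2:ℂ) ^ (1 - zs t)) = conj (1 - (2:ℂ) ^ (zs t)) := by
    rw [zs_conj, map_sub, map_one]
    congr 1
    have := Complex.conj_cpow (2 : ℂ) (conj (zs t)) (by
      rw [← Complex.ofReal_ofNat, Complex.arg_ofReal_of_nonneg (by norm_num)]; exact Real.pi_pos.ne)
    simpa [Complex.conj_ofNat] using this
  rw [h, ← mul_pow, mul_comm, Complex.mul_conj, Complex.normSq_eq_norm_sq]
  unfold zP
  push_cast; ring

lemma zg_conv (θ : ℝ) (h0 : 0 ≤ θ) (h1 : θ < π / 2) (t : ℝ) : MellinConvergent (zg θ) (zs t) :=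
  zA_conv (zc θ) (zc_pos θ h0 h1) _ (by rw [zs_re]; norm_num)

lemma zf_mellin (θ : ℝ) (h0 : 0 ≤ θ) (h1 : θ < π / 2) (t : ℝ) (ht : t ≠ 0) :
    mellin (zf θ) (zs t) = zX t * zP t * Real.exp (θ * t) := by
  have hM : mellin (zg θ) (zs t) = _ :=
    zmellin_two (zc θ) (zc_pos θ h0 h1) (zs t) (by rw [zs_re]; norm_num) (by rw [zs_im]; exact ht)
  have c1 := zg_conv θ h0 h1 t
  have c2 : MellinConvergent (fun x => zg θ ((1/2) * x)) (zs t) :=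
    (MellinConvergent.comp_mul_left (by norm_num)).2 c1
  have c3 : MellinConvergent (fun x => zg θ ((1/4) * x)) (zs t) :=
    (MellinConvergent.comp_mul_left (by norm_num)).2 c1
  have c2' : MellinConvergent (fun x => (2 : ℂ) • zg θ ((1/2) * x)) (zs t) := c2.const_smul 2
  have d1 := hasMellin_sub c1 c2'
  have d2 := hasMellin_add d1.1 c3
  have e1 : mellin (zf θ) (zs t) = Complex.exp (θ / 2 * Complex.I) •
      mellin (fun x => zg θ x - (2:ℂ) • zg θ ((1/2) * x) + zg θ ((1/4) * x)) (zs t) := by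
    rw [← mellin_const_smul]; rfl
  rw [e1, d2.2, d1.2, mellin_const_smul, mellin_comp_mul_left (zg θ) _ (by norm_num : (0:ℝ) < 1/2),
    mellin_comp_mul_left (zg θ) _ (by norm_num : (0:ℝ) < 1/4)]
  have p2 : (((1/2 : ℝ)) : ℂ) ^ (-(zs t)) = 2 ^ (zs t) := by
    rw [one_div, Complex.ofReal_inv, Complex.inv_cpow _ _ (by
      rw [Complex.arg_ofReal_of_nonneg (by norm_num)]; exact Real.pi_pos.ne), Complex.cpow_neg, inv_inv]
    norm_num
  have p4 : (((1/4 : ℝ)) : ℂ) ^ (-(zs t)) = (2 ^ (zs t)) ^ 2 := by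
    rw [← p2, sq, ← Complex.mul_cpow_ofReal_nonneg (by norm_num) (by norm_num)]
    norm_num
  rw [p2, p4, hM]
  have hcc : Complex.exp (θ / 2 * Complex.I) * zc θ ^ (-(zs t)) = Real.exp (θ * t) := by
    have hz0 : zc θ ≠ 0 := Complex.exp_ne_zero _
    rw [Complex.cpow_def_of_ne_zero hz0]
    have : Complex.log (zc θ) = θ * Complex.I := by
      unfold zc
      apply Complex.log_exp <;> simp <;> linarith [Real.pi_pos]
    rw [this, ← Complex.exp_add, Complex.ofReal_exp]
    congr 1
    unfold zs
    push_cast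
    linear_combination (-(θ * t : ℂ)) * Complex.I_mul_I
  rw [← hcc, ← zP_eq]
  unfold zX
  simp only [smul_eq_mul]
  ring

lemma zv_fourier (θ : ℝ) (h0 : 0 ≤ θ) (h1 : θ < π / 2) (ξ : ℝ) (hξ : ξ ≠ 0) :
    𝓕 (zv θ) ξ = zX (2 * π * ξ) * zP (2 * π * ξ) * Real.exp (θ * (2 * π * ξ)) := by
  rw [← zf_mellin θ h0 h1 _ (by have := Real.pi_pos; positivity), mellin_eq_fourier, zs_re, zs_im]
  have : 2 * π * ξ / (2 * π) = ξ := by have := Real.pi_pos; field_simp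
  rw [this]
  rfl

lemma zg_bound (θ : ℝ) (h0 : 0 ≤ θ) (h1 : θ < π / 2) :
    ∃ C a : ℝ, 0 < C ∧ 0 < a ∧ ∀ x : ℝ, 0 < x → ‖zf θ x‖ ≤ C * Real.exp (-(a * x)) := by
  obtain ⟨C, hC, h⟩ := zA_bound (zc θ) (zc_pos θ h0 h1)
  have hc := zc_pos θ h0 h1
  refine ⟨4 * C, π * (zc θ).re / 4, by positivity, by positivity, fun x hx => ?_⟩
  have hp : 0 < π * (zc θ).re := by positivity
  have hb : ∀ y : ℝ, x / 4 ≤ y → ‖zg θ y‖ ≤ C * Real.exp (-(π * (zc θ).re / 4 * x)) := by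
    intro y hy
    refine (h y (by linarith)).trans (mul_le_mul_of_nonneg_left (Real.exp_le_exp.2 ?_) hC.le)
    nlinarith
  unfold zf
  have : ‖Complex.exp (θ / 2 * Complex.I)‖ = 1 := by
    have := Complex.norm_exp_ofReal_mul_I (θ / 2)
    push_cast at this; exact this
  rw [norm_mul, this, one_mul]
  have b1 := hb x (by linarith)
  have b2 := hb (1/2 * x) (by linarith)
  have b3 := hb (1/4 * x) (by linarith)
  calc _ ≤ ‖zg θ x‖ + ‖2 * zg θ (1/2 * x)‖ + ‖zg θ (1/4 * x)‖ :=
        (norm_add_le _ _).trans (add_le_add_left (norm_sub_le _ _) _)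
    _ ≤ _ := by rw [norm_mul, Complex.norm_ofNat]; linarith

lemma zv_cont (θ : ℝ) (h0 : 0 ≤ θ) (h1 : θ < π / 2) : Continuous (zv θ) := by
  have hg : ContinuousOn (zg θ) (Set.Ioi 0) := zA_ray_cont (zc θ) (zc_pos θ h0 h1)
  have hk : ∀ k : ℝ, 0 < k → Continuous (fun u : ℝ => zg θ (k * Real.exp (-u))) := by
    intro k hk
    rw [← continuousOn_univ]
    refine hg.comp (by fun_prop) ?_
    intro u _
    exact mul_pos hk (Real.exp_pos _)
  have h3 : Continuous (fun u : ℝ => zg θ (Real.exp (-u))) := by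
    have := hk 1 one_pos
    refine this.congr fun u => ?_
    rw [one_mul]
  have h4 := hk (1/2) (by norm_num)
  have h5 := hk (1/4) (by norm_num)
  have h6 : Continuous (fun u : ℝ => zf θ (Real.exp (-u))) :=
    continuous_const.mul ((h3.sub (continuous_const.mul h4)).add h5)
  have h7 : Continuous (fun u : ℝ => Real.exp (-(1/2) * u)) := by fun_prop
  exact h7.smul h6

lemma zv_bound (θ : ℝ) (h0 : 0 ≤ θ) (h1 : θ < π / 2) :
    ∃ C : ℝ, 0 < C ∧ ∀ u, ‖zv θ u‖ ≤ C * Real.exp (-(1/2 * |u|)) := by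
  obtain ⟨C, a, hC, ha, h⟩ := zg_bound θ h0 h1
  refine ⟨C * (1 + 1 / a), by positivity, fun u => ?_⟩
  unfold zv
  rw [norm_smul, Real.norm_eq_abs, abs_of_pos (Real.exp_pos _)]
  have hu := h (Real.exp (-u)) (Real.exp_pos _)
  rcases le_total 0 u with hu0 | hu0
  · rw [abs_of_nonneg hu0]
    have h2 : Real.exp (-(a * Real.exp (-u))) ≤ 1 + 1 / a := by
      have : Real.exp (-(a * Real.exp (-u))) ≤ 1 := Real.exp_le_one_iff.2 (by
        have := Real.exp_pos (-u); have := mul_pos ha this; linarith)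
      have : 0 < 1 / a := by positivity
      linarith
    calc Real.exp (-(1/2) * u) * ‖zf θ (Real.exp (-u))‖ ≤ Real.exp (-(1/2) * u) * (C * (1 + 1/a)) := by
          refine mul_le_mul_of_nonneg_left (hu.trans (mul_le_mul_of_nonneg_left h2 hC.le)) (Real.exp_pos _).le
      _ = _ := by rw [neg_mul]; ring
  · rw [abs_of_nonpos hu0]
    have h2 : Real.exp (-(a * Real.exp (-u))) ≤ (1 + 1 / a) * Real.exp u := by
      have e1 : a * Real.exp (-u) ≤ Real.exp (a * Real.exp (-u)) := by
        linarith [Real.add_one_le_exp (a * Real.exp (-u))]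
      have e2 : 0 < a * Real.exp (-u) := mul_pos ha (Real.exp_pos _)
      rw [Real.exp_neg]
      calc (Real.exp (a * Real.exp (-u)))⁻¹ ≤ (a * Real.exp (-u))⁻¹ := inv_anti₀ e2 e1
        _ = 1 / a * Real.exp u := by rw [mul_inv, Real.exp_neg, inv_inv, one_div]
        _ ≤ _ := by have := Real.exp_pos u; nlinarith
    calc Real.exp (-(1/2) * u) * ‖zf θ (Real.exp (-u))‖ ≤ Real.exp (-(1/2) * u) * (C * ((1 + 1/a) * Real.exp u)) := by
          refine mul_le_mul_of_nonneg_left (hu.trans (mul_le_mul_of_nonneg_left h2 hC.le)) (Real.exp_pos _).le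
      _ = C * (1 + 1/a) * (Real.exp (-(1/2) * u) * Real.exp u) := by ring
      _ = _ := by rw [← Real.exp_add]; congr 2; ring

lemma zv_int (θ : ℝ) (h0 : 0 ≤ θ) (h1 : θ < π / 2) : Integrable (zv θ) := by
  obtain ⟨C, hC, h⟩ := zv_bound θ h0 h1
  exact ((zexp_abs_int (1/2) (by norm_num)).const_mul C).mono' (zv_cont θ h0 h1).aestronglyMeasurable
    (Filter.Eventually.of_forall h)

lemma zv_sq_int (θ : ℝ) (h0 : 0 ≤ θ) (h1 : θ < π / 2) : Integrable (fun u => ‖zv θ u‖ ^ 2) := by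
  obtain ⟨C, hC, h⟩ := zv_bound θ h0 h1
  refine ((zexp_abs_int 1 (by norm_num)).const_mul (C ^ 2)).mono'
    ((zv_cont θ h0 h1).norm.pow 2).aestronglyMeasurable (Filter.Eventually.of_forall fun u => ?_)
  rw [Real.norm_eq_abs, abs_of_nonneg (by positivity)]
  calc ‖zv θ u‖ ^ 2 ≤ (C * Real.exp (-(1/2 * |u|))) ^ 2 := pow_le_pow_left₀ (norm_nonneg _) (h u) 2
    _ = _ := by rw [mul_pow, ← Real.exp_nat_mul]; congr 2; push_cast; ring

lemma zH_bound (θ : ℝ) (h0 : 0 ≤ θ) (h1 : θ < π / 2) :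
    ∃ B : ℝ, 0 < B ∧ ∀ t : ℝ, t ≠ 0 → ‖zX t‖ * zP t ≤ B * Real.exp (-(θ * t)) := by
  refine ⟨(∫ u, ‖zv θ u‖) + 1, by positivity, fun t ht => ?_⟩
  have hp := Real.pi_pos
  have h2 := zv_fourier θ h0 h1 (t / (2 * π)) (by positivity)
  have h3 : ‖𝓕 (zv θ) (t / (2 * π))‖ ≤ ∫ u, ‖zv θ u‖ :=
    VectorFourier.norm_fourierIntegral_le_integral_norm _ _ _ _ _
  rw [h2, show 2 * π * (t / (2 * π)) = t by field_simp, norm_mul, norm_mul, Complex.norm_real, Complex.norm_real,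
    Real.norm_eq_abs, Real.norm_eq_abs, abs_of_pos (Real.exp_pos _), abs_of_nonneg (by unfold zP; positivity)] at h3
  have h4 : Real.exp (θ * t) * Real.exp (-(θ * t)) = 1 := by rw [← Real.exp_add]; simp
  have h5 := Real.exp_pos (-(θ * t))
  calc ‖zX t‖ * zP t = ‖zX t‖ * zP t * Real.exp (θ * t) * Real.exp (-(θ * t)) := by rw [mul_assoc (‖zX t‖ * zP t), h4, mul_one]
    _ ≤ ((∫ u, ‖zv θ u‖) + 1) * Real.exp (-(θ * t)) := mul_le_mul_of_nonneg_right (by linarith) h5.le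

lemma zv_fourier_int (θ : ℝ) (h0 : 0 < θ) (h1 : θ < π / 2) : Integrable (𝓕 (zv θ)) := by
  have hcont : Continuous (𝓕 (zv θ)) :=
    VectorFourier.fourierIntegral_continuous Real.continuous_fourierChar (by exact continuous_inner) (zv_int θ h0.le h1)
  set θ' := (θ + π / 2) / 2 with hθ'
  obtain ⟨B, hB, hb⟩ := zH_bound θ' (by rw [hθ']; linarith) (by rw [hθ']; linarith)
  obtain ⟨B', hB', hb'⟩ := zH_bound 0 le_rfl (by linarith)
  set κ := min θ (θ' - θ) with hκ
  have hκp : 0 < κ := lt_min h0 (by rw [hθ']; linarith)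
  have hp := Real.pi_pos
  refine ((zexp_abs_int (κ * (2 * π)) (by positivity)).const_mul (B + B')).mono' hcont.aestronglyMeasurable ?_
  filter_upwards [Measure.ae_ne volume (0:ℝ)] with ξ hξ
  rw [zv_fourier θ h0.le h1 ξ hξ, norm_mul, norm_mul, Complex.norm_real, Complex.norm_real,
    Real.norm_eq_abs, Real.norm_eq_abs, abs_of_pos (Real.exp_pos _), abs_of_nonneg (by unfold zP; positivity)]
  have hne : 2 * π * ξ ≠ 0 := by positivity
  rcases lt_or_gt_of_ne hξ with h | h
  · have := hb' _ hne
    rw [zero_mul, neg_zero, Real.exp_zero, mul_one] at this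
    refine mul_le_mul (this.trans (by linarith)) (Real.exp_le_exp.2 ?_) (Real.exp_pos _).le (by positivity)
    rw [abs_of_neg h]
    have h2 : κ ≤ θ := min_le_left _ _
    have h3 : 0 < 2 * π * (-ξ) := by have : 0 < -ξ := by linarith
                                     positivity
    nlinarith
  · have := hb _ hne
    calc _ ≤ (B * Real.exp (-(θ' * (2 * π * ξ)))) * Real.exp (θ * (2 * π * ξ)) :=
          mul_le_mul_of_nonneg_right this (Real.exp_pos _).le
      _ = B * Real.exp (-((θ' - θ) * (2 * π * ξ))) := by
          rw [mul_assoc, ← Real.exp_add]; congr 2; ring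
      _ ≤ _ := by
        refine mul_le_mul (by linarith) (Real.exp_le_exp.2 ?_) (Real.exp_pos _).le (by positivity)
        rw [abs_of_pos h]
        have h2 : κ ≤ θ' - θ := min_le_right _ _
        have h3 : 0 < 2 * π * ξ := by positivity
        nlinarith

end PartFive

section PartSix
open scoped FourierTransform ComplexConjugate

lemma zs_ne_neg (t : ℝ) (n : ℕ) : zs t ≠ -n := by
  intro h
  have := congrArg Complex.re h
  rw [zs_re] at this
  simp at this
  have h2 : (0:ℝ) ≤ n := Nat.cast_nonneg n
  linarith

lemma zs_ne_one (t : ℝ) : zs t ≠ 1 := by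
  intro h
  have := congrArg Complex.re h
  rw [zs_re] at this
  norm_num at this

lemma zsin_norm (t : ℝ) : Real.exp (π * |t|) / 9 ≤ ‖Complex.sin (π * zs t / 2)‖ ^ 2 := by
  have e : (π * zs t / 2 : ℂ) = ((π / 4 : ℝ) : ℂ) + ((π * t / 2 : ℝ) : ℂ) * Complex.I := by
    unfold zs; push_cast; ring
  rw [e, Complex.sin_add_mul_I, ← Complex.normSq_eq_norm_sq]
  rw [← Complex.ofReal_sin, ← Complex.ofReal_cos, ← Complex.ofReal_cosh, ← Complex.ofReal_sinh,
    ← Complex.ofReal_mul, ← Complex.ofReal_mul, Complex.normSq_add_mul_I, Real.sin_pi_div_four, Real.cos_pi_div_four]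
  have h1 : Real.exp (π * |t|) ≤ 4 * Real.cosh (π * t / 2) ^ 2 := by
    have h2 : Real.exp (π * |t| / 2) ≤ 2 * Real.cosh (π * t / 2) := by
      rw [← Real.cosh_abs, Real.cosh_eq]
      have : |π * t / 2| = π * |t| / 2 := by
        rw [abs_div, abs_mul, abs_of_pos Real.pi_pos]; norm_num
      rw [this]
      have := Real.exp_pos (-(π * |t| / 2))
      linarith
    calc Real.exp (π * |t|) = Real.exp (π * |t| / 2) ^ 2 := by rw [← Real.exp_nat_mul]; congr 1; push_cast; ring
      _ ≤ (2 * Real.cosh (π * t / 2)) ^ 2 := pow_le_pow_left₀ (Real.exp_pos _).le h2 2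
      _ = _ := by ring
  have h3 : (√2 / 2) ^ 2 = 1 / 2 := by rw [div_pow, Real.sq_sqrt (by norm_num)]; norm_num
  rw [mul_pow, mul_pow, h3]
  have := Real.exp_pos (π * |t|)
  nlinarith [sq_nonneg (Real.sinh (π * t / 2))]

lemma zX_conj (t : ℝ) :
    conj (zX t) * Complex.sin (π * zs t / 2) = zX t * Complex.cos (π * zs t / 2) := by
  have h2pi : (2 * π : ℂ) ≠ 0 := by simp [Real.pi_ne_zero]
  have hc : conj (zX t) = (2 * π : ℂ) ^ (-(1 - zs t)) * Complex.Gamma (1 - zs t) * riemannZeta (1 - zs t) ^ 2 := by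
    unfold zX
    rw [map_mul, map_mul, map_pow, ← Complex.Gamma_conj, ← riemannZeta_conj, zs_conj]
    congr 2
    have := Complex.conj_cpow (2 * π : ℂ) (conj (-(zs t))) (by
      rw [← Complex.ofReal_ofNat, ← Complex.ofReal_mul, Complex.arg_ofReal_of_nonneg (by positivity)]; exact Real.pi_pos.ne)
    simpa [Complex.conj_ofNat] using this.symm
  rw [hc, riemannZeta_one_sub (zs_ne_neg t) (zs_ne_one t)]
  have hG := Complex.Gamma_mul_Gamma_one_sub (zs t)
  have hsin : Complex.sin (π * zs t) = 2 * Complex.sin (π * zs t / 2) * Complex.cos (π * zs t / 2) := by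
    rw [← Complex.sin_two_mul]; congr 1; ring
  have hs0 : Complex.sin (π * zs t) ≠ 0 := by
    intro h
    rw [h, div_zero] at hG
    rcases mul_eq_zero.1 hG with h | h
    · exact Complex.Gamma_ne_zero (zs_ne_neg t) h
    · rw [zs_conj, Complex.Gamma_conj, map_eq_zero] at h
      exact Complex.Gamma_ne_zero (zs_ne_neg t) h
  rw [eq_div_iff hs0, hsin] at hG
  have e1 : (2 * π : ℂ) ^ (-(1 - zs t)) = (2 * π : ℂ) ^ (zs t) / (2 * π) := by
    rw [neg_sub, Complex.cpow_sub _ _ h2pi, Complex.cpow_one]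
  have e2 : (2 * π : ℂ) ^ (zs t) * (2 * π : ℂ) ^ (-(zs t)) = 1 := by
    rw [Complex.cpow_neg, mul_inv_cancel₀]
    simp [Complex.cpow_eq_zero_iff, Real.pi_ne_zero]
  rw [e1]
  unfold zX
  have hpi : (π : ℂ) ≠ 0 := by simp [Real.pi_ne_zero]
  generalize (2 * π : ℂ) ^ (zs t) = a at *
  generalize (2 * π : ℂ) ^ (-(zs t)) = b at *
  generalize Complex.Gamma (1 - zs t) = G' at *
  generalize Complex.Gamma (zs t) = G at *
  generalize Complex.sin (π * zs t / 2) = S at *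
  generalize Complex.cos (π * zs t / 2) = C at *
  generalize riemannZeta (zs t) = Z at *
  field_simp
  linear_combination (b * G * C * Z ^ 2 * G' * G * 2 * S * C) * e2 + (b * G * C * Z ^ 2) * hG

lemma zX_comb (t : ℝ) : ‖conj (zX t) + Complex.I * zX t‖ ^ 2 * Real.exp (π * |t|) ≤
    9 * (‖zX t‖ ^ 2 * Real.exp (-(π * t))) := by
  have h1 : (conj (zX t) + Complex.I * zX t) * Complex.sin (π * zs t / 2) =
      zX t * Complex.exp ((π * zs t / 2) * Complex.I) := by
    rw [add_mul, zX_conj, Complex.exp_mul_I]; ring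
  have h2 := congrArg (fun z => ‖z‖ ^ 2) h1
  simp only [norm_mul, mul_pow] at h2
  have h3 : ‖Complex.exp ((π * zs t / 2) * Complex.I)‖ ^ 2 = Real.exp (-(π * t)) := by
    rw [Complex.norm_exp, ← Real.exp_nat_mul]
    congr 1
    unfold zs
    simp
    ring
  rw [h3] at h2
  have h4 := zsin_norm t
  rw [← h2]
  have h5 := sq_nonneg ‖conj (zX t) + Complex.I * zX t‖
  nlinarith

lemma zK : ∃ K : ℝ, ∀ θ : ℝ, π / 4 ≤ θ → θ < π / 2 →
    ∫ ξ, ‖conj (𝓕 (zv θ) ξ) + Complex.I * 𝓕 (zv θ) ξ‖ ^ 2 ≤ K := by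
  have hp := Real.pi_pos
  obtain ⟨B, hB, hb⟩ := zH_bound 0 le_rfl (by linarith)
  refine ⟨∫ ξ, 9 * B ^ 2 * Real.exp (-((π / 2 * (2 * π)) * |ξ|)), fun θ h0 h1 => ?_⟩
  refine integral_mono_of_nonneg (Filter.Eventually.of_forall fun ξ => by positivity)
    ((zexp_abs_int _ (by positivity)).const_mul _) ?_
  filter_upwards [Measure.ae_ne volume (0:ℝ)] with ξ hξ
  rw [zv_fourier θ (by linarith) h1 ξ hξ]
  have hne : 2 * π * ξ ≠ 0 := by positivity
  have hb' := hb _ hne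
  rw [zero_mul, neg_zero, Real.exp_zero, mul_one] at hb'
  have habs : |2 * π * ξ| = 2 * π * |ξ| := by rw [abs_mul, abs_of_pos (by positivity)]
  have hX := zX_comb (2 * π * ξ)
  have hle : θ * (2 * π * ξ) * 2 - π * (2 * π * ξ) ≤ π / 2 * (2 * π * |ξ|) := by
    have h2 : -(2 * π * |ξ|) ≤ 2 * π * ξ := by rw [← habs]; exact neg_abs_le _
    have h3 : 2 * π * ξ ≤ (2 * π * |ξ|) := by rw [← habs]; exact le_abs_self _
    have h4 : 0 ≤ 2 * π * |ξ| := by positivity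
    nlinarith
  rw [habs] at hX
  generalize 2 * π * ξ = t at *
  have hP : 0 ≤ zP t := by unfold zP; positivity
  have e1 : conj (zX t * zP t * Real.exp (θ * t)) + Complex.I * (zX t * zP t * Real.exp (θ * t)) =
      (conj (zX t) + Complex.I * zX t) * ((zP t * Real.exp (θ * t) : ℝ) : ℂ) := by
    simp only [map_mul, Complex.conj_ofReal]; push_cast; ring
  simp only [e1]
  rw [norm_mul, Complex.norm_real, Real.norm_eq_abs, abs_of_nonneg (by positivity), mul_pow, mul_pow, ← Real.exp_nat_mul]
  set N := ‖conj (zX t) + Complex.I * zX t‖ ^ 2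
  have hN : N ≤ 9 * (‖zX t‖ ^ 2 * Real.exp (-(π * t))) * Real.exp (-(π * (2 * π * |ξ|))) := by
    rw [Real.exp_neg (π * (2 * π * |ξ|)), ← div_eq_mul_inv, le_div_iff₀ (Real.exp_pos _)]
    exact hX
  have hsq : (‖zX t‖ * zP t) ^ 2 ≤ B ^ 2 := pow_le_pow_left₀ (by positivity) hb' 2
  calc N * (zP t ^ 2 * Real.exp ((2:ℕ) * (θ * t))) ≤
      (9 * (‖zX t‖ ^ 2 * Real.exp (-(π * t))) * Real.exp (-(π * (2 * π * |ξ|)))) * (zP t ^ 2 * Real.exp ((2:ℕ) * (θ * t))) :=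
        mul_le_mul_of_nonneg_right hN (by positivity)
    _ = 9 * (‖zX t‖ * zP t) ^ 2 * (Real.exp (-(π * t)) * Real.exp (-(π * (2 * π * |ξ|))) * Real.exp ((2:ℕ) * (θ * t))) := by ring
    _ ≤ 9 * B ^ 2 * Real.exp (-((π / 2 * (2 * π)) * |ξ|)) := by
      refine mul_le_mul (by linarith) ?_ (by positivity) (by positivity)
      rw [← Real.exp_add, ← Real.exp_add]
      apply Real.exp_le_exp.2
      push_cast
      nlinarith

lemma zgamma_norm (t : ℝ) : ‖Complex.Gamma (zs t)‖ ^ 2 = π / Real.cosh (π * t) := by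
  have h := Complex.Gamma_mul_Gamma_one_sub (zs t)
  rw [zs_conj, Complex.Gamma_conj, Complex.mul_conj, Complex.normSq_eq_norm_sq] at h
  have e : (π * zs t : ℂ) = π * t * Complex.I + π / 2 := by unfold zs; ring
  rw [e, Complex.sin_add_pi_div_two, Complex.cos_mul_I, ← Complex.ofReal_mul, ← Complex.ofReal_cosh,
    ← Complex.ofReal_div] at h
  exact_mod_cast h

lemma zP_lower (t : ℝ) : (1 / 256 : ℝ) ≤ zP t := by
  unfold zP
  have h1 : ‖(2:ℂ) ^ (zs t)‖ = √2 := by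
    have := Complex.norm_cpow_eq_rpow_re_of_pos (x := 2) (by norm_num) (zs t)
    rw [zs_re] at this
    rw [Real.sqrt_eq_rpow, ← this]; norm_num
  have h2 := norm_sub_norm_le ((2:ℂ) ^ (zs t)) 1
  rw [h1, norm_one, norm_sub_rev] at h2
  have h3 : (1.25:ℝ) ≤ √2 := Real.le_sqrt_of_sq_le (by norm_num)
  have h4 : (1/4 : ℝ) ≤ ‖1 - (2:ℂ) ^ (zs t)‖ := by linarith
  calc (1/256 : ℝ) = (1/4) ^ 4 := by norm_num
    _ ≤ _ := pow_le_pow_left₀ (by norm_num) h4 4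

lemma zF_lower (t : ℝ) (ht : 0 < t) :
    (1 / 256) ^ 2 * (1 / 2) * (‖riemannZeta (zs t)‖ ^ 4 * Real.exp (-(π * t))) ≤ (‖zX t‖ * zP t) ^ 2 := by
  have hp := Real.pi_pos
  have hX : ‖zX t‖ ^ 2 = (2 * π)⁻¹ * (π / Real.cosh (π * t)) * ‖riemannZeta (zs t)‖ ^ 4 := by
    unfold zX
    rw [norm_mul, norm_mul, norm_pow, mul_pow, mul_pow, zgamma_norm]
    have : ‖(2 * π : ℂ) ^ (-(zs t))‖ = (2 * π) ^ (-(1/2 : ℝ)) := by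
      have := Complex.norm_cpow_eq_rpow_re_of_pos (x := 2 * π) (by positivity) (-(zs t))
      rw [Complex.neg_re, zs_re] at this
      rw [← this]; norm_num
    rw [this, ← Real.rpow_natCast, ← Real.rpow_mul (by positivity)]
    rw [show -(1/2 : ℝ) * ((2:ℕ) : ℝ) = -1 by norm_num, Real.rpow_neg_one]
    ring
  rw [mul_pow, hX]
  have hc : Real.cosh (π * t) ≤ Real.exp (π * t) := by
    rw [Real.cosh_eq]
    have : Real.exp (-(π * t)) ≤ Real.exp (π * t) := Real.exp_le_exp.2 (by nlinarith [mul_pos hp ht])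
    linarith
  have h1 : Real.exp (-(π * t)) ≤ 1 / Real.cosh (π * t) := by
    rw [Real.exp_neg, one_div]; exact inv_anti₀ (Real.cosh_pos _) hc
  have hP : (1/256 : ℝ) ^ 2 ≤ zP t ^ 2 := pow_le_pow_left₀ (by norm_num) (zP_lower t) 2
  have hZ : 0 ≤ ‖riemannZeta (zs t)‖ ^ 4 := by positivity
  have e : (2 * π)⁻¹ * (π / Real.cosh (π * t)) = 1 / 2 * (1 / Real.cosh (π * t)) := by field_simp
  rw [e]
  calc _ = (1/256) ^ 2 * (1 / 2 * Real.exp (-(π * t)) * ‖riemannZeta (zs t)‖ ^ 4) := by ring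
    _ ≤ zP t ^ 2 * (1 / 2 * (1 / Real.cosh (π * t)) * ‖riemannZeta (zs t)‖ ^ 4) := by
      refine mul_le_mul hP ?_ (by positivity) (by positivity)
      exact mul_le_mul_of_nonneg_right (by linarith) hZ
    _ = _ := by ring

end PartSix

section PartSeven
open scoped ENNReal

/-- product index -/
def zN (p : ℕ × ℕ) : ℕ := (p.1 + 1) * (p.2 + 1)

noncomputable def zD (n : ℕ) : ℝ≥0∞ := ∑' p : ℕ × ℕ, if zN p = n then 1 else 0

lemma zD_sum (f : ℕ → ℝ≥0∞) : ∑' p : ℕ × ℕ, f (zN p) = ∑' n, zD n * f n := by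
  unfold zD
  simp_rw [← ENNReal.tsum_mul_right]
  rw [ENNReal.tsum_comm]
  refine tsum_congr fun p => ?_
  simp_rw [ite_mul, one_mul, zero_mul]
  rw [tsum_eq_single (zN p)]
  · simp
  · intro b hb; rw [if_neg (Ne.symm hb)]

lemma zD_zero : zD 0 = 0 := by
  unfold zD
  rw [ENNReal.tsum_eq_zero]
  intro p
  rw [if_neg]
  unfold zN; positivity

lemma zD_card (n : ℕ) (hn : n ≠ 0) : zD n = (n.divisors.card : ℝ≥0∞) := by
  unfold zD
  rw [tsum_eq_sum (s := Finset.range n ×ˢ Finset.range n)]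
  · rw [Finset.sum_boole]
    congr 1
    refine Finset.card_bij (fun p _ => p.1 + 1) ?_ ?_ ?_
    · intro p hp
      simp only [Finset.mem_filter, Nat.mem_divisors] at hp ⊢
      exact ⟨⟨p.2 + 1, hp.2.symm⟩, hn⟩
    · intro p hp q hq h
      rw [Finset.mem_filter] at hp hq
      unfold zN at hp hq
      have h1 : p.1 = q.1 := by simpa using h
      have h2 := hp.2.trans hq.2.symm
      rw [h1] at h2
      have h3 := Nat.eq_of_mul_eq_mul_left (Nat.succ_pos _) h2
      exact Prod.ext h1 (by simpa using h3)
    · intro d hd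
      rw [Nat.mem_divisors] at hd
      obtain ⟨e, he⟩ := hd.1
      have hd0 : d ≠ 0 := by rintro rfl; simp at he; exact hn he
      have he0 : e ≠ 0 := by rintro rfl; simp at he; exact hn he
      refine ⟨(d - 1, e - 1), ?_, by simp; omega⟩
      have h1 : d ≤ n := Nat.le_of_dvd (Nat.pos_of_ne_zero hn) ⟨e, he⟩
      have h2 : e ≤ n := Nat.le_of_dvd (Nat.pos_of_ne_zero hn) ⟨d, by rw [he, mul_comm]⟩
      rw [Finset.mem_filter, Finset.mem_product, Finset.mem_range, Finset.mem_range]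
      unfold zN
      refine ⟨⟨by show d - 1 < n; omega, by show e - 1 < n; omega⟩, ?_⟩
      show (d - 1 + 1) * (e - 1 + 1) = n
      rw [Nat.sub_add_cancel (by omega), Nat.sub_add_cancel (by omega), he]
  · intro p hp
    rw [if_neg]
    intro h
    apply hp
    simp only [Finset.mem_product, Finset.mem_range]
    unfold zN at h
    constructor <;> nlinarith

lemma zD_mul (m n : ℕ) (hm : m ≠ 0) (hn : n ≠ 0) : zD (m * n) ≤ zD m * zD n := by
  rw [zD_card _ hm, zD_card _ hn, zD_card _ (mul_ne_zero hm hn)]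
  open scoped Pointwise in
  have : (m * n).divisors.card ≤ m.divisors.card * n.divisors.card := by
    rw [Nat.divisors_mul]
    exact Finset.card_mul_le
  exact_mod_cast this

noncomputable def zw (σ : ℝ) (n : ℕ) : ℝ≥0∞ := ENNReal.ofReal ((n : ℝ) ^ (-σ))

lemma zw_mul (σ : ℝ) (p : ℕ × ℕ) : zw σ (zN p) = zw σ (p.1 + 1) * zw σ (p.2 + 1) := by
  unfold zw zN
  rw [← ENNReal.ofReal_mul (by positivity), ← Real.mul_rpow (by positivity) (by positivity)]
  push_cast; rfl

lemma zw_sum (σ : ℝ) (hσ : 1 < σ) : ∑' n, zw σ n ≠ ∞ := by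
  unfold zw
  rw [← ENNReal.ofReal_tsum_of_nonneg (fun n => by positivity) (Real.summable_nat_rpow.2 (by linarith))]
  exact ENNReal.ofReal_ne_top

lemma zsucc_le (f : ℕ → ℝ≥0∞) : ∑' n, f (n + 1) ≤ ∑' n, f n :=
  ENNReal.tsum_comp_le_tsum_of_injective (fun a b h => by simpa using h) f

lemma zprod_sum (f g : ℕ → ℝ≥0∞) : ∑' p : ℕ × ℕ, f p.1 * g p.2 = (∑' n, f n) * ∑' n, g n := by
  rw [ENNReal.tsum_prod']
  simp_rw [ENNReal.tsum_mul_left, ENNReal.tsum_mul_right]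

lemma zD_first (σ : ℝ) (hσ : 1 < σ) : ∑' n, zD n * zw σ n ≠ ∞ := by
  rw [← zD_sum]
  simp_rw [zw_mul]
  rw [zprod_sum (fun n => zw σ (n + 1)) (fun n => zw σ (n + 1))]
  have : ∑' n, zw σ (n + 1) ≠ ∞ := ne_top_of_le_ne_top (zw_sum σ hσ) (zsucc_le _)
  exact ENNReal.mul_ne_top this this

lemma zD_second (σ : ℝ) (hσ : 1 < σ) : ∑' n, zD n * (zD n * zw σ n) ≠ ∞ := by
  rw [← zD_sum (fun n => zD n * zw σ n)]
  have h1 : ∑' n, zD (n + 1) * zw σ (n + 1) ≠ ∞ :=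
    ne_top_of_le_ne_top (zD_first σ hσ) (zsucc_le (fun n => zD n * zw σ n))
  refine ne_top_of_le_ne_top (ENNReal.mul_ne_top h1 h1) ?_
  rw [← zprod_sum]
  refine ENNReal.tsum_le_tsum fun p => ?_
  rw [zw_mul]
  calc zD (zN p) * (zw σ (p.1 + 1) * zw σ (p.2 + 1)) ≤ (zD (p.1 + 1) * zD (p.2 + 1)) * (zw σ (p.1 + 1) * zw σ (p.2 + 1)) :=
        mul_le_mul_left (zD_mul _ _ (Nat.succ_ne_zero _) (Nat.succ_ne_zero _)) _
    _ = _ := by ring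

end PartSeven

section PartEight
open scoped ENNReal

lemma zexp_rpow (r : ℝ) (hr : 0 < r) (y : ℝ) (hy : 0 < y) : Real.exp (-y) ≤ r ^ r * y ^ (-r) := by
  have h1 : y / r ≤ Real.exp (y / r) := by linarith [Real.add_one_le_exp (y / r)]
  have h2 : (y / r) ^ r ≤ Real.exp y := by
    calc (y / r) ^ r ≤ Real.exp (y / r) ^ r := Real.rpow_le_rpow (by positivity) h1 hr.le
      _ = Real.exp y := by rw [← Real.exp_mul]; congr 1; field_simp
  rw [Real.exp_neg]
  calc (Real.exp y)⁻¹ ≤ ((y / r) ^ r)⁻¹ := inv_anti₀ (by positivity) h2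
    _ = r ^ r * y ^ (-r) := by
      rw [Real.div_rpow hy.le hr.le, inv_div, Real.rpow_neg hy.le, div_eq_mul_inv]

lemma zexp_scaled (r : ℝ) (hr : 0 < r) (q : ℝ) (hq : 0 < q) :
    ∃ C : ℝ, 0 < C ∧ ∀ a m : ℝ, 0 < a → 0 < m → Real.exp (-(m * a * q)) ≤ C * (a ^ (-r) * m ^ (-r)) := by
  refine ⟨r ^ r * q ^ (-r), by positivity, fun a m ha hm => ?_⟩
  refine (zexp_rpow r hr _ (by positivity)).trans (le_of_eq ?_)
  rw [Real.mul_rpow (by positivity) hq.le, Real.mul_rpow hm.le ha.le]; ring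

lemma zsplit (e n h : ℝ) (he : 0 < e) (hn : 0 < n) (hh : 0 < h) :
    n ^ (-e) / h ≤ n ^ (-(1 + e)) + h ^ (-(1 + e)) := by
  have e1 : ∀ x : ℝ, 0 < x → x ^ (-(1 + e)) = x ^ (-e) / x := by
    intro x hx
    rw [show -(1 + e) = -e - 1 by ring, Real.rpow_sub_one hx.ne']
  rw [e1 n hn, e1 h hh]
  have p1 : 0 ≤ n ^ (-e) / n := by positivity
  have p2 : 0 ≤ h ^ (-e) / h := by positivity
  rcases le_total n h with h1 | h1
  · have : n ^ (-e) / h ≤ n ^ (-e) / n := div_le_div_of_nonneg_left (by positivity) hn h1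
    linarith
  · have : n ^ (-e) / h ≤ h ^ (-e) / h :=
      div_le_div_of_nonneg_right (Real.rpow_le_rpow_of_nonpos hh h1 (by linarith)) hh.le
    linarith

lemma zoff (e : ℝ) (he : 0 < e) : ∃ C : ℝ, 0 < C ∧ ∀ a m n h : ℝ, 0 < a → 0 < m → 0 < n → 0 < h →
    Real.exp (-((m + n) * a / 4)) / h ≤
      C * a ^ (-(1 + 2 * e)) * (m ^ (-(1 + e)) * (n ^ (-(1 + e)) + h ^ (-(1 + e)))) := by
  obtain ⟨C1, hC1, h1⟩ := zexp_scaled (1 + e) (by linarith) (1/4) (by norm_num)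
  obtain ⟨C2, hC2, h2⟩ := zexp_scaled e he (1/4) (by norm_num)
  refine ⟨C1 * C2, by positivity, fun a m n h ha hm hn hh => ?_⟩
  have e1 : Real.exp (-((m + n) * a / 4)) = Real.exp (-(m * a * (1/4))) * Real.exp (-(n * a * (1/4))) := by
    rw [← Real.exp_add]; congr 1; ring
  have e2 : a ^ (-(1 + 2 * e)) = a ^ (-(1 + e)) * a ^ (-e) := by rw [← Real.rpow_add ha]; congr 1; ring
  rw [e1, e2]
  calc _ ≤ (C1 * (a ^ (-(1 + e)) * m ^ (-(1 + e)))) * (C2 * (a ^ (-e) * n ^ (-e))) / h := by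
        refine div_le_div_of_nonneg_right ?_ hh.le
        exact mul_le_mul (h1 a m ha hm) (h2 a n ha hn) (Real.exp_pos _).le (by positivity)
    _ = C1 * C2 * (a ^ (-(1 + e)) * a ^ (-e)) * (m ^ (-(1 + e)) * (n ^ (-e) / h)) := by ring
    _ ≤ _ := by
      refine mul_le_mul_of_nonneg_left ?_ (by positivity)
      exact mul_le_mul_of_nonneg_left (zsplit e n h he hn hh) (by positivity)

lemma zdiag (e : ℝ) (he : 0 < e) : ∃ C : ℝ, 0 < C ∧ ∀ a m : ℝ, 0 < a → 1 ≤ m →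
    Real.exp (-((m + m) * a / 4)) / ((m + m) * a) ≤ C * a ^ (-(1 + 2 * e)) * m ^ (-(1 + e)) := by
  obtain ⟨C1, hC1, h1⟩ := zexp_scaled (2 * e) (by linarith) (1/2) (by norm_num)
  refine ⟨C1, by positivity, fun a m ha hm => ?_⟩
  have hm0 : 0 < m := by linarith
  have e1 : Real.exp (-((m + m) * a / 4)) = Real.exp (-(m * a * (1/2))) := by congr 1; ring
  have e2 : a ^ (-(1 + 2 * e)) = a ^ (-(2 * e)) / a := by
    rw [show -(1 + 2 * e) = -(2 * e) - 1 by ring, Real.rpow_sub_one ha.ne']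
  have e3 : m ^ (-(1 + e)) = m ^ (-e) / m := by
    rw [show -(1 + e) = -e - 1 by ring, Real.rpow_sub_one hm0.ne']
  have e4 : m ^ (-(2 * e)) ≤ m ^ (-e) := Real.rpow_le_rpow_of_exponent_le hm (by linarith)
  rw [e1, e2, e3]
  calc _ ≤ Real.exp (-(m * a * (1/2))) / (m * a) := by
        refine div_le_div_of_nonneg_left (Real.exp_pos _).le (by positivity) ?_
        nlinarith [mul_pos hm0 ha]
    _ ≤ C1 * (a ^ (-(2 * e)) * m ^ (-e)) / (m * a) := by
        refine div_le_div_of_nonneg_right ((h1 a m ha hm0).trans ?_) (by positivity)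
        refine mul_le_mul_of_nonneg_left (mul_le_mul_of_nonneg_left e4 (by positivity)) hC1.le
    _ = _ := by field_simp

noncomputable def zW (a : ℝ) (m n : ℕ) : ℝ :=
  Real.exp (-(((m : ℝ) + n) * a / 4)) / max (((m : ℝ) + n) * a) |(n : ℝ) - m|

noncomputable def zgz (σ : ℝ) (j : ℤ) : ℝ≥0∞ := ENNReal.ofReal (|(j : ℝ)| ^ (-σ)) + if j = 0 then 1 else 0

lemma zgz_sum (σ : ℝ) (hσ : 1 < σ) : ∑' j, zgz σ j ≠ ∞ := by
  unfold zgz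
  rw [ENNReal.tsum_add, tsum_ite_eq,
    ← ENNReal.ofReal_tsum_of_nonneg (fun n => by positivity) (Real.summable_abs_int_rpow hσ)]
  simp

lemma zW_bound (e : ℝ) (he : 0 < e) : ∃ C : ℝ, 0 < C ∧ ∀ a : ℝ, 0 < a → ∀ m n : ℕ, m ≠ 0 → n ≠ 0 →
    ENNReal.ofReal (zW a m n) ≤ ENNReal.ofReal (C * a ^ (-(1 + 2 * e))) *
      (zw (1 + e) m * (zw (1 + e) n + zgz (1 + e) ((n : ℤ) - m))) := by
  obtain ⟨C1, hC1, h1⟩ := zoff e he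
  obtain ⟨C2, hC2, h2⟩ := zdiag e he
  refine ⟨C1 + C2, by positivity, fun a ha m n hm hn => ?_⟩
  have hm1 : (1:ℝ) ≤ m := by exact_mod_cast Nat.one_le_iff_ne_zero.2 hm
  have hn1 : (1:ℝ) ≤ n := by exact_mod_cast Nat.one_le_iff_ne_zero.2 hn
  by_cases hmn : m = n
  · subst hmn
    have hw : zW a m m = Real.exp (-(((m : ℝ) + m) * a / 4)) / (((m : ℝ) + m) * a) := by
      unfold zW; rw [sub_self, abs_zero, max_eq_left (by positivity)]
    have : (1 : ℝ≥0∞) ≤ zw (1 + e) m + zgz (1 + e) ((m : ℤ) - m) := by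
      unfold zgz; rw [sub_self, if_pos rfl]
      exact le_add_left (le_add_left le_rfl)
    calc ENNReal.ofReal (zW a m m) ≤ ENNReal.ofReal ((C1 + C2) * a ^ (-(1 + 2 * e)) * (m:ℝ) ^ (-(1 + e))) := by
          refine ENNReal.ofReal_le_ofReal ?_
          rw [hw]
          refine (h2 a m ha hm1).trans ?_
          refine mul_le_mul_of_nonneg_right (mul_le_mul_of_nonneg_right (by linarith) (by positivity)) (by positivity)
      _ = ENNReal.ofReal ((C1 + C2) * a ^ (-(1 + 2 * e))) * (zw (1 + e) m * 1) := by
          rw [ENNReal.ofReal_mul (by positivity), mul_one]; rfl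
      _ ≤ _ := by gcongr
  · have hd : (0:ℝ) < |(n:ℝ) - m| := by
      rw [abs_pos, sub_ne_zero]; exact_mod_cast Ne.symm hmn
    have hk : zw (1 + e) n + zgz (1 + e) ((n : ℤ) - m) =
        ENNReal.ofReal ((n:ℝ) ^ (-(1 + e)) + |(n:ℝ) - m| ^ (-(1 + e))) := by
      unfold zgz zw
      rw [if_neg (by rw [sub_eq_zero]; exact_mod_cast Ne.symm hmn), add_zero, ENNReal.ofReal_add (by positivity) (by positivity)]
      push_cast; rfl
    rw [hk]
    unfold zw
    rw [← ENNReal.ofReal_mul (by positivity), ← ENNReal.ofReal_mul (by positivity)]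
    refine ENNReal.ofReal_le_ofReal ?_
    calc zW a m n ≤ Real.exp (-(((m : ℝ) + n) * a / 4)) / |(n:ℝ) - m| :=
          div_le_div_of_nonneg_left (Real.exp_pos _).le hd (le_max_right _ _)
      _ ≤ _ := h1 a m n _ ha (by linarith) (by linarith) hd
      _ ≤ _ := by
        refine mul_le_mul_of_nonneg_right (mul_le_mul_of_nonneg_right (by linarith) (by positivity)) (by positivity)

lemma zW_symm (a : ℝ) (m n : ℕ) : zW a m n = zW a n m := by
  unfold zW; rw [abs_sub_comm, add_comm (m:ℝ)]

lemma zdouble (e : ℝ) (he : 0 < e) : ∃ C : ℝ, 0 < C ∧ ∀ a : ℝ, 0 < a →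
    ∑' (p : ℕ × ℕ), ∑' (q : ℕ × ℕ), ENNReal.ofReal (zW a (zN p) (zN q)) ≤ ENNReal.ofReal (C * a ^ (-(1 + 2 * e))) := by
  obtain ⟨C, hC, h⟩ := zW_bound e he
  set S : ℝ≥0∞ := ∑' n, zD n * (zD n * zw (1 + e) n) with hS
  have hSf : S ≠ ∞ := zD_second _ (by linarith)
  set Z : ℝ≥0∞ := ∑' n, zw (1 + e) n + ∑' j, zgz (1 + e) j with hZ
  have hZf : Z ≠ ∞ := ENNReal.add_ne_top.2 ⟨zw_sum _ (by linarith), zgz_sum _ (by linarith)⟩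
  refine ⟨C * (2 * (S * Z).toReal + 1), by positivity, fun a ha => ?_⟩
  set w : ℕ → ℕ → ℝ≥0∞ := fun m n => if m = 0 ∨ n = 0 then 0 else ENNReal.ofReal (zW a m n) with hw
  have hwsymm : ∀ m n, w m n = w n m := by
    intro m n; simp only [hw, or_comm (a := m = 0), zW_symm a m n]
  have hNne : ∀ p, zN p ≠ 0 := fun p => by unfold zN; positivity
  have e1 : ∑' (p : ℕ × ℕ), ∑' (q : ℕ × ℕ), ENNReal.ofReal (zW a (zN p) (zN q)) = ∑' m, ∑' n, zD m * (zD n * w m n) := by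
    have : ∀ p q, ENNReal.ofReal (zW a (zN p) (zN q)) = w (zN p) (zN q) := by
      intro p q; simp [hw, hNne]
    simp_rw [this]
    simp_rw [fun p => zD_sum (fun n => w (zN p) n)]
    rw [zD_sum (fun m => ∑' n, zD n * w m n)]
    simp_rw [ENNReal.tsum_mul_left]
  rw [e1]
  have e2 : ∑' m, ∑' n, zD m * (zD n * w m n) ≤ ∑' m, ∑' n, (zD m * zD m * w m n + zD n * zD n * w n m) := by
    refine ENNReal.tsum_le_tsum fun m => ENNReal.tsum_le_tsum fun n => ?_
    rw [hwsymm n m, ← mul_assoc, ← add_mul]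
    refine mul_le_mul_left ?_ _
    rcases le_total (zD m) (zD n) with h1 | h1
    · exact (mul_le_mul_left h1 _).trans (le_add_left le_rfl)
    · exact (mul_le_mul_right h1 _).trans (le_add_right le_rfl)
  have e3 : ∑' m, ∑' n, (zD m * zD m * w m n + zD n * zD n * w n m) = 2 * ∑' m, ∑' n, zD m * zD m * w m n := by
    simp_rw [ENNReal.tsum_add]
    rw [ENNReal.tsum_comm (f := fun m n => zD n * zD n * w n m), two_mul]
  have e4 : ∀ m, ∑' n, zD m * zD m * w m n ≤
      ENNReal.ofReal (C * a ^ (-(1 + 2 * e))) * (zD m * (zD m * zw (1 + e) m)) * Z := by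
    intro m
    rw [ENNReal.tsum_mul_left]
    have : ∑' n, w m n ≤ ENNReal.ofReal (C * a ^ (-(1 + 2 * e))) * (zw (1 + e) m * Z) := by
      calc ∑' n, w m n ≤ ∑' n : ℕ, ENNReal.ofReal (C * a ^ (-(1 + 2 * e))) *
            (zw (1 + e) m * (zw (1 + e) n + zgz (1 + e) ((n : ℤ) - m))) := by
            refine ENNReal.tsum_le_tsum fun n => ?_
            simp only [hw]
            split_ifs with hc
            · exact zero_le
            · push Not at hc
              exact h a ha m n hc.1 hc.2
        _ = ENNReal.ofReal (C * a ^ (-(1 + 2 * e))) * (zw (1 + e) m *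
              (∑' n, zw (1 + e) n + ∑' n : ℕ, zgz (1 + e) ((n : ℤ) - m))) := by
            rw [ENNReal.tsum_mul_left, ENNReal.tsum_mul_left, ENNReal.tsum_add]
        _ ≤ _ := by
            gcongr
            refine add_le_add le_rfl ?_
            exact ENNReal.tsum_comp_le_tsum_of_injective (f := fun n : ℕ => (n : ℤ) - m) (fun x y hxy => by simpa using hxy) (zgz (1 + e))
    calc zD m * zD m * ∑' n, w m n ≤ zD m * zD m * (ENNReal.ofReal (C * a ^ (-(1 + 2 * e))) * (zw (1 + e) m * Z)) := by gcongr
      _ = _ := by ring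
  calc _ ≤ _ := e2
    _ = _ := e3
    _ ≤ 2 * ∑' m, ENNReal.ofReal (C * a ^ (-(1 + 2 * e))) * (zD m * (zD m * zw (1 + e) m)) * Z := by
        gcongr with m; exact e4 m
    _ = ENNReal.ofReal (C * a ^ (-(1 + 2 * e))) * (2 * (S * Z)) := by
        rw [ENNReal.tsum_mul_right, ENNReal.tsum_mul_left]; ring
    _ ≤ ENNReal.ofReal (C * a ^ (-(1 + 2 * e))) * ENNReal.ofReal (2 * (S * Z).toReal + 1) := by
        gcongr
        have hf : S * Z ≠ ∞ := ENNReal.mul_ne_top hSf hZf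
        rw [ENNReal.ofReal_add (by positivity) (by norm_num), ENNReal.ofReal_mul (by norm_num), ENNReal.ofReal_toReal hf]
        simp
    _ = _ := by rw [← ENNReal.ofReal_mul (by positivity)]; congr 1; ring

end PartEight

section PartNine
open scoped ENNReal ComplexConjugate

noncomputable def zrate (c : ℂ) (r : (ℕ × ℕ) × (ℕ × ℕ)) : ℂ := -(zfr r.1 * c + zfr r.2 * conj c)

lemma zrate_re (c : ℂ) (r : (ℕ × ℕ) × (ℕ × ℕ)) : (zrate c r).re = -((zfr r.1 + zfr r.2) * c.re) := by
  unfold zrate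
  rw [Complex.neg_re, Complex.add_re, Complex.re_ofReal_mul, Complex.re_ofReal_mul, Complex.conj_re]; ring

lemma zrate_im (c : ℂ) (r : (ℕ × ℕ) × (ℕ × ℕ)) : (zrate c r).im = (zfr r.2 - zfr r.1) * c.im := by
  unfold zrate
  rw [Complex.neg_im, Complex.add_im, Complex.im_ofReal_mul, Complex.im_ofReal_mul, Complex.conj_im]; ring

lemma zfr_eq (p : ℕ × ℕ) : zfr p = 2 * π * (zN p : ℝ) := by
  unfold zfr zN; push_cast; rfl

noncomputable def zterm (c : ℂ) (r : (ℕ × ℕ) × (ℕ × ℕ)) (x : ℝ) : ℂ :=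
  (-1 : ℂ) ^ (r.1.1 + r.1.2) * (-1 : ℂ) ^ (r.2.1 + r.2.2) * Complex.exp (zrate c r * x)

lemma zterm_norm' (c : ℂ) (r : (ℕ × ℕ) × (ℕ × ℕ)) (x : ℝ) :
    ‖zterm c r x‖ = Real.exp (-((zfr r.1 + zfr r.2) * c.re) * x) := by
  unfold zterm
  rw [norm_mul, norm_mul, norm_pow, norm_pow, norm_neg, norm_one, one_pow, one_pow, one_mul, one_mul,
    Complex.norm_exp, Complex.re_mul_ofReal, zrate_re]

lemma zterm_int (c : ℂ) (hc : 0 < c.re) (r : (ℕ × ℕ) × (ℕ × ℕ)) :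
    IntegrableOn (zterm c r) (Set.Ioi (1/4)) := by
  unfold zterm
  apply Integrable.const_mul
  apply integrableOn_exp_mul_complex_Ioi
  rw [zrate_re]
  have := zfr_pos r.1; have := zfr_pos r.2
  have : 0 < (zfr r.1 + zfr r.2) * c.re := by positivity
  linarith

lemma zterm_norm_int (c : ℂ) (hc : 0 < c.re) (r : (ℕ × ℕ) × (ℕ × ℕ)) :
    ∫ x in Set.Ioi (1/4 : ℝ), ‖zterm c r x‖ =
      Real.exp (-((zfr r.1 + zfr r.2) * c.re) * (1/4)) / ((zfr r.1 + zfr r.2) * c.re) := by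
  simp_rw [zterm_norm']
  have := zfr_pos r.1; have := zfr_pos r.2
  have hp : 0 < (zfr r.1 + zfr r.2) * c.re := by positivity
  rw [integral_exp_mul_Ioi (by linarith)]
  rw [neg_div_neg_eq]

lemma zterm_summ (c : ℂ) (hc : 0 < c.re) :
    Summable (fun r => ∫ x in Set.Ioi (1/4 : ℝ), ‖zterm c r x‖) := by
  have h0 : Summable (fun p : ℕ × ℕ => Real.exp (-(zfr p * (c.re / 4)))) := by
    refine Summable.of_nonneg_of_le (fun p => (Real.exp_pos _).le) (fun p => ?_) (zgeom_summable (c.re / 4) (by linarith))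
    have := zexp_le p (c.re / 4) (by linarith) ((c.re / 4 : ℝ) : ℂ) (by simp)
    rwa [Complex.ofReal_re] at this
  have h1 := (h0.mul_of_nonneg h0 (fun p => (Real.exp_pos _).le) (fun p => (Real.exp_pos _).le)).mul_right
    (1 / (2 * π * c.re))
  refine Summable.of_nonneg_of_le (fun r => integral_nonneg fun x => norm_nonneg _) (fun r => ?_) h1
  rw [zterm_norm_int c hc]
  have hp := Real.pi_pos
  have a1 := zfr_pos r.1
  have a2 := zfr_pos r.2
  have a3 : 2 * π ≤ zfr r.1 := by
    rw [zfr_eq]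
    have : (1:ℝ) ≤ zN r.1 := by
      have : 1 ≤ zN r.1 := by unfold zN; exact Nat.one_le_iff_ne_zero.2 (by positivity)
      exact_mod_cast this
    nlinarith
  have e : -((zfr r.1 + zfr r.2) * c.re) * (1/4) = -(zfr r.1 * (c.re / 4)) + -(zfr r.2 * (c.re / 4)) := by ring
  rw [e, ← Real.exp_add, mul_one_div]
  refine div_le_div_of_nonneg_left (Real.exp_pos _).le (by positivity) ?_
  exact mul_le_mul_of_nonneg_right (by linarith) hc.le

lemma zconj_aux {ι : Type} (a : ι → ℂ) (z : ℂ) (h : HasSum a z) :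
    HasSum (fun p => conj (a p)) (conj z) := 
  h.map (starRingEnd ℂ) Complex.continuous_conj

lemma zconj_sq' {ι : Type} (a b : ι → ℂ) (z w : ℂ) (h : HasSum a z) (h3 : HasSum b w) :
    HasSum (fun r : ι × ι => a r.1 * b r.2) (z * w) := by
  have s1 : Summable (fun p => ‖a p‖) := h.summable.norm
  have s2 : Summable (fun p => ‖b p‖) := h3.summable.norm
  have s3 := summable_mul_of_summable_norm s1 s2
  exact h.mul h3 s3

lemma zconj_sq {ι : Type} (a : ι → ℂ) (z : ℂ) (h : HasSum a z) :
    HasSum (fun r : ι × ι => a r.1 * conj (a r.2)) ((‖z‖ ^ 2 : ℝ) : ℂ) := by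
  have hm := zconj_sq' a _ z _ h (zconj_aux a z h)
  rw [Complex.mul_conj, Complex.normSq_eq_norm_sq] at hm
  exact hm

lemma zterm_eq (c : ℂ) (x : ℝ) (r : (ℕ × ℕ) × (ℕ × ℕ)) :
    zterm c r x = ((-1 : ℂ) ^ (r.1.1 + r.1.2) * Complex.exp (-(zfr r.1 * (x * c)))) *
      conj ((-1 : ℂ) ^ (r.2.1 + r.2.2) * Complex.exp (-(zfr r.2 * (x * c)))) := by
  unfold zterm zrate
  rw [map_mul, map_pow, map_neg, map_one, ← Complex.exp_conj]
  simp only [map_neg, map_mul, Complex.conj_ofReal]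
  rw [mul_mul_mul_comm, ← Complex.exp_add]
  congr 2
  ring

lemma zsq_hasSum (c : ℂ) (hc : 0 < c.re) (x : ℝ) (hx : 0 < x) :
    HasSum (fun r => zterm c r x) ((‖zA (x * c)‖ ^ 2 : ℝ) : ℂ) := by
  have hre : 0 < ((x : ℂ) * c).re := by rw [Complex.re_ofReal_mul]; positivity
  have h1 := zterm_summable _ hre
  have h2 := zconj_sq _ _ h1.hasSum
  have e : (fun r => zterm c r x) = _ := funext (zterm_eq c x)
  rw [e]
  exact h2

lemma zterm_val (c : ℂ) (hc : 0 < c.re) (hi : 1 ≤ 2 * π * c.im) (r : (ℕ × ℕ) × (ℕ × ℕ)) :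
    ‖∫ x in Set.Ioi (1/4 : ℝ), zterm c r x‖ ≤ zW (2 * π * c.re) (zN r.1) (zN r.2) := by
  have hp := Real.pi_pos
  have a1 := zfr_pos r.1
  have a2 := zfr_pos r.2
  have hp : 0 < (zfr r.1 + zfr r.2) * c.re := by positivity
  unfold zterm
  rw [integral_const_mul, integral_exp_mul_complex_Ioi (by rw [zrate_re]; linarith), norm_mul, norm_mul, norm_pow, norm_pow, norm_neg, norm_one,
    one_pow, one_pow, one_mul, one_mul, norm_div, norm_neg, Complex.norm_exp]
  have e1 : (zrate c r * ((1/4 : ℝ) : ℂ)).re = -((((zN r.1 : ℝ)) + zN r.2) * (2 * π * c.re) / 4) := by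
    rw [Complex.re_mul_ofReal, zrate_re, zfr_eq, zfr_eq]; ring
  rw [e1]
  unfold zW
  have hN : (0:ℝ) < zN r.1 := by
    have : 0 < zN r.1 := by unfold zN; positivity
    exact_mod_cast this
  refine div_le_div_of_nonneg_left (Real.exp_pos _).le (lt_max_of_lt_left (by positivity)) (max_le ?_ ?_)
  · refine le_trans ?_ (Complex.abs_re_le_norm _)
    rw [zrate_re, abs_neg, abs_of_pos hp, zfr_eq, zfr_eq]
    apply le_of_eq; ring
  · refine le_trans ?_ (Complex.abs_im_le_norm _)
    rw [zrate_im, zfr_eq, zfr_eq]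
    have : (2 * π * (zN r.2 : ℝ) - 2 * π * (zN r.1 : ℝ)) * c.im = (2 * π * c.im) * ((zN r.2 : ℝ) - zN r.1) := by ring
    rw [this, abs_mul, abs_of_nonneg (by linarith : 0 ≤ 2 * π * c.im)]
    exact le_mul_of_one_le_left (abs_nonneg _) hi

lemma zsq_int (c : ℂ) (hc : 0 < c.re) (hi : 1 ≤ 2 * π * c.im) (R : ℝ) (hR : 0 ≤ R)
    (h : ∑' (p : ℕ × ℕ), ∑' (q : ℕ × ℕ), ENNReal.ofReal (zW (2 * π * c.re) (zN p) (zN q)) ≤ ENNReal.ofReal R) :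
    ∫ x in Set.Ioi (1/4 : ℝ), ‖zA (x * c)‖ ^ 2 ≤ R := by
  have key := hasSum_integral_of_summable_integral_norm (fun r => zterm_int c hc r) (zterm_summ c hc)
  have e1 : ∫ x in Set.Ioi (1/4 : ℝ), (∑' r, zterm c r x) = ((∫ x in Set.Ioi (1/4 : ℝ), ‖zA (x * c)‖ ^ 2 : ℝ) : ℂ) := by
    rw [← integral_complex_ofReal]
    refine setIntegral_congr_fun measurableSet_Ioi fun x hx => ?_
    have hx : (1/4 : ℝ) < x := hx
    exact (zsq_hasSum c hc x (by linarith)).tsum_eq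
  rw [e1] at key
  have hW0 : ∀ r : (ℕ × ℕ) × (ℕ × ℕ), 0 ≤ zW (2 * π * c.re) (zN r.1) (zN r.2) := fun r =>
    (norm_nonneg _).trans (zterm_val c hc hi r)
  have hsum : Summable (fun r : (ℕ × ℕ) × (ℕ × ℕ) => zW (2 * π * c.re) (zN r.1) (zN r.2)) := by
    have : ∑' r : (ℕ × ℕ) × (ℕ × ℕ), ENNReal.ofReal (zW (2 * π * c.re) (zN r.1) (zN r.2)) ≠ ∞ := by
      rw [ENNReal.tsum_prod']
      exact ne_top_of_le_ne_top ENNReal.ofReal_ne_top h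
    have h2 := ENNReal.summable_toReal this
    refine h2.congr fun r => ?_
    rw [ENNReal.toReal_ofReal (hW0 r)]
  have hle : ∑' r : (ℕ × ℕ) × (ℕ × ℕ), zW (2 * π * c.re) (zN r.1) (zN r.2) ≤ R := by
    rw [← ENNReal.ofReal_le_ofReal_iff hR, ENNReal.ofReal_tsum_of_nonneg hW0 hsum, ENNReal.tsum_prod']
    exact h
  have h3 : ‖((∫ x in Set.Ioi (1/4 : ℝ), ‖zA (x * c)‖ ^ 2 : ℝ) : ℂ)‖ ≤ R := by
    rw [← key.tsum_eq]
    exact (tsum_of_norm_bounded hsum.hasSum (zterm_val c hc hi)).trans hle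
  rw [Complex.norm_real] at h3
  exact (le_abs_self _).trans h3

end PartNine

section PartTen
open scoped ENNReal ComplexConjugate FourierTransform

lemma zsubst (F : ℝ → ℝ) : ∫ u in Set.Iic (0:ℝ), Real.exp (-u) * F (Real.exp (-u)) = ∫ x in Set.Ioi (1:ℝ), F x := by
  have himg : (fun u : ℝ => Real.exp (-u)) '' Set.Iic 0 = Set.Ici 1 := by
    ext y
    simp only [Set.mem_image, Set.mem_Iic, Set.mem_Ici]
    constructor
    · rintro ⟨u, hu, rfl⟩
      exact Real.one_le_exp (by linarith)
    · intro hy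
      refine ⟨-Real.log y, by linarith [Real.log_nonneg hy], ?_⟩
      rw [neg_neg, Real.exp_log (by linarith)]
  have h := integral_image_eq_integral_abs_deriv_smul (s := Set.Iic (0:ℝ)) (f := fun u : ℝ => Real.exp (-u))
    (f' := fun u => -Real.exp (-u)) measurableSet_Iic
    (fun u _ => by
      have := ((hasDerivAt_neg u).exp).hasDerivWithinAt (s := Set.Iic (0:ℝ))
      simpa using this)
    (fun a _ b _ hab => by
      have := Real.exp_injective hab
      linarith) F
  rw [himg, integral_Ici_eq_integral_Ioi] at h
  rw [h]
  refine setIntegral_congr_fun measurableSet_Iic fun u _ => ?_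
  simp only [abs_neg, abs_of_pos (Real.exp_pos _), smul_eq_mul]

lemma zg_sq_int (θ : ℝ) (h0 : 0 ≤ θ) (h1 : θ < π / 2) : IntegrableOn (fun x => ‖zg θ x‖ ^ 2) (Set.Ioi (1/4)) := by
  obtain ⟨C, hC, h⟩ := zA_bound (zc θ) (zc_pos θ h0 h1)
  have hc := zc_pos θ h0 h1
  have hp := Real.pi_pos
  have hi : IntegrableOn (fun x : ℝ => C ^ 2 * Real.exp ((-(π * (zc θ).re)) * x)) (Set.Ioi (1/4)) :=
    (integrableOn_exp_mul_Ioi (neg_neg_of_pos (by positivity)) _).const_mul _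
  refine Integrable.mono' hi ?_ ?_
  · have hg : ContinuousOn (zg θ) (Set.Ioi 0) := zA_ray_cont (zc θ) hc
    refine ContinuousOn.aestronglyMeasurable ?_ measurableSet_Ioi
    exact ((hg.mono (Set.Ioi_subset_Ioi (by norm_num))).norm).pow 2
  · refine (ae_restrict_iff' measurableSet_Ioi).2 (Filter.Eventually.of_forall fun x hx => ?_)
    have hx : (1/4 : ℝ) < x := hx
    rw [Real.norm_of_nonneg (by positivity)]
    refine (pow_le_pow_left₀ (norm_nonneg _) (h x (by linarith)) 2).trans ?_
    rw [mul_pow]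
    refine mul_le_mul_of_nonneg_left ?_ (by positivity)
    rw [← Real.exp_nat_mul]
    apply Real.exp_le_exp.2
    have : 0 ≤ π * (zc θ).re * x := by positivity
    push_cast
    linarith

lemma zf_sq (θ x : ℝ) : ‖zf θ x‖ ^ 2 ≤ 3 * ‖zg θ x‖ ^ 2 + 12 * ‖zg θ ((1/2) * x)‖ ^ 2 + 3 * ‖zg θ ((1/4) * x)‖ ^ 2 := by
  unfold zf
  have e1 : ‖Complex.exp (θ / 2 * Complex.I)‖ = 1 := by
    rw [show (θ / 2 * Complex.I : ℂ) = ((θ / 2 : ℝ) : ℂ) * Complex.I by push_cast; rfl]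
    exact Complex.norm_exp_ofReal_mul_I _
  rw [norm_mul, e1, one_mul]
  have e2 : ‖zg θ x - 2 * zg θ ((1/2) * x) + zg θ ((1/4) * x)‖ ≤ ‖zg θ x‖ + 2 * ‖zg θ ((1/2) * x)‖ + ‖zg θ ((1/4) * x)‖ := by
    refine (norm_add_le _ _).trans (add_le_add_left ((norm_sub_le _ _).trans (le_of_eq ?_)) _)
    rw [norm_mul, Complex.norm_ofNat]
  refine (pow_le_pow_left₀ (norm_nonneg _) e2 2).trans ?_
  nlinarith [sq_nonneg (‖zg θ x‖ - 2 * ‖zg θ ((1/2) * x)‖), sq_nonneg (‖zg θ x‖ - ‖zg θ ((1/4) * x)‖),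
    sq_nonneg (2 * ‖zg θ ((1/2) * x)‖ - ‖zg θ ((1/4) * x)‖)]

lemma zg_scale (θ : ℝ) (h0 : 0 ≤ θ) (h1 : θ < π / 2) (k : ℝ) (hk : 1/4 ≤ k) :
    IntegrableOn (fun x => ‖zg θ (k * x)‖ ^ 2) (Set.Ioi 1) ∧
    ∫ x in Set.Ioi (1:ℝ), ‖zg θ (k * x)‖ ^ 2 ≤ 4 * ∫ x in Set.Ioi (1/4 : ℝ), ‖zg θ x‖ ^ 2 := by
  have hi := zg_sq_int θ h0 h1
  have hk0 : 0 < k := by linarith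
  have hsub : Set.Ioi (k * 1) ⊆ Set.Ioi (1/4 : ℝ) := Set.Ioi_subset_Ioi (by linarith)
  constructor
  · exact (integrableOn_Ioi_comp_mul_left_iff (fun x => ‖zg θ x‖ ^ 2) 1 hk0).2 (hi.mono_set hsub)
  · rw [integral_comp_mul_left_Ioi (fun x => ‖zg θ x‖ ^ 2) 1 hk0, smul_eq_mul]
    refine mul_le_mul ?_ ?_ (integral_nonneg fun x => by positivity) (by norm_num)
    · rw [inv_le_comm₀ hk0 (by norm_num)]; linarith
    · exact setIntegral_mono_set hi (Filter.Eventually.of_forall fun x => by positivity)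
        (Filter.Eventually.of_forall hsub)

lemma zv_half (θ : ℝ) (h0 : 0 ≤ θ) (h1 : θ < π / 2) :
    ∫ u in Set.Iic (0:ℝ), ‖zv θ u‖ ^ 2 ≤ 72 * ∫ x in Set.Ioi (1/4 : ℝ), ‖zg θ x‖ ^ 2 := by
  have e : ∀ u, ‖zv θ u‖ ^ 2 = Real.exp (-u) * (fun x => ‖zf θ x‖ ^ 2) (Real.exp (-u)) := by
    intro u
    simp only [zv]
    rw [norm_smul, mul_pow, Real.norm_of_nonneg (Real.exp_pos _).le, ← Real.exp_nat_mul]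
    congr 2; push_cast; ring
  simp_rw [e]
  rw [zsubst (fun x => ‖zf θ x‖ ^ 2)]
  obtain ⟨i1, b1⟩ := zg_scale θ h0 h1 1 (by norm_num)
  obtain ⟨i2, b2⟩ := zg_scale θ h0 h1 (1/2) (by norm_num)
  obtain ⟨i3, b3⟩ := zg_scale θ h0 h1 (1/4) (by norm_num)
  simp only [one_mul] at i1 b1
  have hm : ∫ x in Set.Ioi (1:ℝ), ‖zf θ x‖ ^ 2 ≤
      ∫ x in Set.Ioi (1:ℝ), (3 * ‖zg θ x‖ ^ 2 + 12 * ‖zg θ ((1/2) * x)‖ ^ 2 + 3 * ‖zg θ ((1/4) * x)‖ ^ 2) := by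
    refine integral_mono_of_nonneg (Filter.Eventually.of_forall fun x => by positivity)
      (((i1.const_mul 3).add (i2.const_mul 12)).add (i3.const_mul 3)) (Filter.Eventually.of_forall fun x => zf_sq θ x)
  have i12 : IntegrableOn (fun x => 3 * ‖zg θ x‖ ^ 2 + 12 * ‖zg θ ((1/2) * x)‖ ^ 2) (Set.Ioi 1) :=
    (i1.const_mul 3).add (i2.const_mul 12)
  rw [integral_add i12 (i3.const_mul 3), integral_add (i1.const_mul 3) (i2.const_mul 12),
    integral_const_mul, integral_const_mul, integral_const_mul] at hm
  linarith

lemma zfourth_fourier (e : ℝ) (he : 0 < e) : ∃ C : ℝ, 0 < C ∧ ∀ δ : ℝ, 0 < δ → δ ≤ π / 4 →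
    ∫ ξ, ‖𝓕 (zv (π / 2 - δ)) ξ‖ ^ 2 ≤ C * δ ^ (-(1 + 2 * e)) := by
  obtain ⟨K, hK⟩ := zK
  obtain ⟨C, hC, hd⟩ := zdouble e he
  refine ⟨216 * C + 2 * |K|, by positivity, fun δ hδ hδ1 => ?_⟩
  have hp := Real.pi_pos
  have hp3 := Real.pi_gt_three
  have h0 : 0 < π / 2 - δ := by linarith
  have h1 : π / 2 - δ < π / 2 := by linarith
  have hre : (zc (π / 2 - δ)).re = Real.sin δ := by rw [zc_re, Real.cos_pi_div_two_sub]
  have him : (zc (π / 2 - δ)).im = Real.cos δ := by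
    unfold zc
    rw [Complex.exp_ofReal_mul_I_im, Real.sin_pi_div_two_sub]
  have hs : 2 / π * δ ≤ Real.sin δ := Real.mul_le_sin hδ.le (by linarith)
  have hcos : 1 / 2 ≤ Real.cos δ := by
    rw [← Real.cos_pi_div_three]
    exact Real.cos_le_cos_of_nonneg_of_le_pi hδ.le (by linarith) (by linarith)
  have hB : 0 ≤ C * δ ^ (-(1 + 2 * e)) := by positivity
  have hs' : δ ≤ 2 * π * Real.sin δ := by
    have : 2 * π * (2 / π * δ) = 4 * δ := by field_simp; ring
    nlinarith
  have hz : ∫ x in Set.Ioi (1/4 : ℝ), ‖zg (π / 2 - δ) x‖ ^ 2 ≤ C * δ ^ (-(1 + 2 * e)) := by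
    refine zsq_int (zc (π / 2 - δ)) (zc_pos _ h0.le h1) (by rw [him]; nlinarith) _ hB ?_
    refine (hd _ (by rw [hre]; linarith)).trans (ENNReal.ofReal_le_ofReal ?_)
    rw [hre]
    exact mul_le_mul_of_nonneg_left (Real.rpow_le_rpow_of_nonpos hδ hs' (by linarith)) hC.le
  have hv := zv_half _ h0.le h1
  have hfin := aux_half (zv (π / 2 - δ)) (zv_cont _ h0.le h1) (zv_int _ h0.le h1) (zv_fourier_int _ h0 h1)
    (zv_sq_int _ h0.le h1) K (hK _ (by linarith) h1)
  have hone : 1 ≤ δ ^ (-(1 + 2 * e)) :=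
    Real.one_le_rpow_of_pos_of_le_one_of_nonpos hδ (by linarith [Real.pi_le_four]) (by linarith)
  have hKK : K ≤ |K| * δ ^ (-(1 + 2 * e)) := (le_abs_self K).trans (le_mul_of_one_le_right (abs_nonneg _) hone)
  nlinarith

end PartTen

section PartEleven
open scoped ENNReal ComplexConjugate FourierTransform

lemma zzeta_cont : Continuous (fun t : ℝ => riemannZeta (zs t)) := by
  rw [continuous_iff_continuousAt]
  intro t
  have h1 : ContinuousAt riemannZeta (zs t) := (differentiableAt_riemannZeta (zs_ne_one t)).continuousAt
  have h2 : ContinuousAt zs t := by unfold zs; fun_prop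
  exact ContinuousAt.comp h1 h2

lemma zzeta_neg (t : ℝ) : ‖riemannZeta (zs (-t))‖ = ‖riemannZeta (zs t)‖ := by
  have : zs (-t) = conj (zs t) := by
    apply Complex.ext
    · rw [Complex.conj_re, zs_re, zs_re]
    · rw [Complex.conj_im, zs_im, zs_im]
  rw [this, riemannZeta_conj, RCLike.norm_conj]

lemma zzeta_abs (t : ℝ) : ‖riemannZeta (zs |t|)‖ = ‖riemannZeta (zs t)‖ := by
  rcases abs_choice t with h | h
  · rw [h]
  · rw [h, zzeta_neg]

noncomputable def zG (δ t : ℝ) : ℝ := ‖riemannZeta (zs t)‖ ^ 4 * Real.exp (-(2 * δ * |t|))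

lemma zG_cont (δ : ℝ) : Continuous (zG δ) := by
  unfold zG
  exact (zzeta_cont.norm.pow 4).mul (by fun_prop)

lemma zG_pt (δ : ℝ) (hδ : 0 < δ) (hδ1 : δ ≤ π / 4) (ξ : ℝ) (hξ : ξ ≠ 0) :
    zG δ (2 * π * ξ) ≤ 131072 * (‖𝓕 (zv (π / 2 - δ)) ξ‖ ^ 2 + ‖𝓕 (zv (π / 2 - δ)) (-ξ)‖ ^ 2) := by
  have hp := Real.pi_pos
  have h0 : 0 < π / 2 - δ := by linarith
  have h1 : π / 2 - δ < π / 2 := by linarith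
  have key : zG δ (2 * π * ξ) ≤ 131072 * ‖𝓕 (zv (π / 2 - δ)) |ξ|‖ ^ 2 := by
    have hx : 0 < |ξ| := abs_pos.2 hξ
    rw [zv_fourier _ h0.le h1 _ hx.ne']
    have ht : 0 < 2 * π * |ξ| := by positivity
    have hl := zF_lower _ ht
    have ea : |2 * π * ξ| = 2 * π * |ξ| := by rw [abs_mul, abs_of_pos (by positivity)]
    unfold zG
    rw [← zzeta_abs, ea]
    set t := 2 * π * |ξ| with htd
    rw [norm_mul, norm_mul, Complex.norm_real, Complex.norm_real, Real.norm_of_nonneg (Real.exp_pos _).le,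
      Real.norm_of_nonneg (by unfold zP; positivity), mul_pow]
    have e2 : Real.exp (-(2 * δ * t)) = Real.exp (-(π * t)) * Real.exp ((π / 2 - δ) * t) ^ 2 := by
      rw [← Real.exp_nat_mul, ← Real.exp_add]; congr 1; push_cast; ring
    rw [e2]
    have := mul_le_mul_of_nonneg_right hl (sq_nonneg (Real.exp ((π / 2 - δ) * t)))
    nlinarith
  refine key.trans ?_
  rcases abs_choice ξ with h | h <;> rw [h]
  · nlinarith [sq_nonneg ‖𝓕 (zv (π / 2 - δ)) (-ξ)‖]
  · nlinarith [sq_nonneg ‖𝓕 (zv (π / 2 - δ)) ξ‖]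

lemma zF_sq_int (θ : ℝ) (h0 : 0 < θ) (h1 : θ < π / 2) : Integrable (fun ξ => ‖𝓕 (zv θ) ξ‖ ^ 2) := by
  have hi := zv_fourier_int θ h0 h1
  have hcont : Continuous (𝓕 (zv θ)) :=
    VectorFourier.fourierIntegral_continuous Real.continuous_fourierChar (by exact continuous_inner) (zv_int θ h0.le h1)
  refine (hi.norm.const_mul (∫ u, ‖zv θ u‖)).mono' (hcont.norm.pow 2).aestronglyMeasurable
    (Filter.Eventually.of_forall fun ξ => ?_)
  rw [Real.norm_of_nonneg (by positivity), sq]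
  refine mul_le_mul_of_nonneg_right ?_ (norm_nonneg _)
  exact VectorFourier.norm_fourierIntegral_le_integral_norm _ _ _ _ _

lemma zfourth (e : ℝ) (he : 0 < e) : ∃ C : ℝ, 0 < C ∧ ∀ δ : ℝ, 0 < δ → δ ≤ π / 4 →
    Integrable (zG δ) ∧ ∫ t, zG δ t ≤ C * δ ^ (-(1 + 2 * e)) := by
  obtain ⟨C, hC, h⟩ := zfourth_fourier e he
  have hp := Real.pi_pos
  refine ⟨2 * π * (131072 * (2 * C)), by positivity, fun δ hδ hδ1 => ?_⟩
  have h0 : 0 < π / 2 - δ := by linarith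
  have h1 : π / 2 - δ < π / 2 := by linarith
  have hF := zF_sq_int _ h0 h1
  have hFn : Integrable (fun ξ => ‖𝓕 (zv (π / 2 - δ)) (-ξ)‖ ^ 2) := hF.comp_neg
  have hsum : Integrable (fun ξ => 131072 * (‖𝓕 (zv (π / 2 - δ)) ξ‖ ^ 2 + ‖𝓕 (zv (π / 2 - δ)) (-ξ)‖ ^ 2)) :=
    (hF.add hFn).const_mul _
  have hae : ∀ᵐ ξ : ℝ, zG δ (2 * π * ξ) ≤ 131072 * (‖𝓕 (zv (π / 2 - δ)) ξ‖ ^ 2 + ‖𝓕 (zv (π / 2 - δ)) (-ξ)‖ ^ 2) := by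
    filter_upwards [compl_mem_ae_iff.2 (measure_singleton (μ := volume) (0:ℝ))] with ξ hξ
    exact zG_pt δ hδ hδ1 ξ hξ
  have hnn : ∀ t, 0 ≤ zG δ t := fun t => by unfold zG; positivity
  have hint : Integrable (fun ξ => zG δ (2 * π * ξ)) := by
    refine hsum.mono' ((zG_cont δ).comp (by fun_prop)).aestronglyMeasurable ?_
    filter_upwards [hae] with ξ hξ
    rwa [Real.norm_of_nonneg (hnn _)]
  refine ⟨(integrable_comp_mul_left_iff (zG δ) (by positivity : 2 * π ≠ 0)).1 hint, ?_⟩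
  have hb := integral_mono_ae hint hsum hae
  rw [integral_const_mul, integral_add hF hFn, integral_neg_eq_self (fun ξ => ‖𝓕 (zv (π / 2 - δ)) ξ‖ ^ 2),
    Measure.integral_comp_mul_left, abs_of_pos (by positivity), smul_eq_mul] at hb
  have hh := h δ hδ hδ1
  have : ∫ t, zG δ t = (2 * π) * ((2 * π)⁻¹ * ∫ t, zG δ t) := by field_simp
  rw [this, mul_assoc (2 * π)]
  refine mul_le_mul_of_nonneg_left (hb.trans ?_) (by positivity)
  linarith

end PartEleven

section PartTwelve

lemma zarg (t u : ℝ) : 1 / 2 + Complex.I * (t : ℂ) + Complex.I * (u : ℂ) = zs (t + u) := by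
  unfold zs; push_cast; ring

noncomputable def zq2 (G u : ℝ) : ℝ := Real.exp 2 / (Real.sqrt π * G) * Real.exp (-(1 / (2 * G ^ 2)) * u ^ 2)

noncomputable def zw2 (G u : ℝ) : ℝ := 1 / (Real.sqrt π * G) * Real.exp (-(u / G) ^ 2)

lemma zq2_int (G : ℝ) (hG : 0 < G) : Integrable (zq2 G) := by
  unfold zq2
  exact (integrable_exp_neg_mul_sq (by positivity)).const_mul _

lemma zq2_val (G : ℝ) (hG : 0 < G) : ∫ u, zq2 G u ≤ 2 * Real.exp 2 := by
  unfold zq2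
  have hp := Real.pi_pos
  rw [integral_const_mul, integral_gaussian]
  have e : π / (1 / (2 * G ^ 2)) = π * (G ^ 2 * 2) := by field_simp
  rw [e, Real.sqrt_mul hp.le, Real.sqrt_mul (by positivity), Real.sqrt_sq hG.le]
  have h2 : Real.sqrt 2 ≤ 2 := by rw [Real.sqrt_le_left (by norm_num)]; norm_num
  have : 0 < Real.sqrt π := Real.sqrt_pos.2 hp
  have e2 : Real.exp 2 / (Real.sqrt π * G) * (Real.sqrt π * (G * Real.sqrt 2)) = Real.sqrt 2 * Real.exp 2 := by
    field_simp
  rw [e2]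
  exact mul_le_mul_of_nonneg_right h2 (Real.exp_pos _).le

lemma zw2_eq (G u : ℝ) : zw2 G u = 1 / (Real.sqrt π * G) * Real.exp (-(1 / G ^ 2) * u ^ 2) := by
  unfold zw2; congr 2; rw [div_pow]; ring

lemma zw2_int (G : ℝ) (hG : 0 < G) : Integrable (zw2 G) := by
  have : zw2 G = _ := funext (zw2_eq G)
  rw [this]
  exact (integrable_exp_neg_mul_sq (by positivity)).const_mul _

lemma zw2_val (G : ℝ) (hG : 0 < G) : ∫ u, zw2 G u = 1 := by
  simp_rw [zw2_eq]
  have hp := Real.pi_pos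
  rw [integral_const_mul, integral_gaussian]
  have e : π / (1 / (G ^ 2)) = π * G ^ 2 := by field_simp
  rw [e, Real.sqrt_mul hp.le, Real.sqrt_sq hG.le]
  have : 0 < Real.sqrt π := Real.sqrt_pos.2 hp
  field_simp

lemma zpt (T G t u : ℝ) (hT : 0 < T) (hG : 0 < G) (hGT : G ≤ T) (ht0 : 0 ≤ t) (ht : t ≤ 2 * T) :
    zw2 G u * ‖riemannZeta (zs (t + u))‖ ^ 4 ≤ Real.exp 4 * (zq2 G u * zG (1 / T) (t + u)) := by
  unfold zw2 zq2 zG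
  have hp := Real.pi_pos
  have key : Real.exp (-(u / G) ^ 2) ≤ Real.exp 4 * (Real.exp 2 * Real.exp (-(1 / (2 * G ^ 2)) * u ^ 2) *
      Real.exp (-(2 * (1 / T) * |t + u|))) := by
    rw [← Real.exp_add, ← Real.exp_add, ← Real.exp_add]
    apply Real.exp_le_exp.2
    have h1 : |t + u| ≤ 2 * T + |u| := (abs_add_le _ _).trans (by rw [abs_of_nonneg ht0]; linarith)
    have h2 : (1 / T) * |t + u| ≤ 2 + |u| / G := by
      calc (1 / T) * |t + u| ≤ (1 / T) * (2 * T + |u|) := mul_le_mul_of_nonneg_left h1 (by positivity)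
        _ = 2 + |u| / T := by field_simp
        _ ≤ 2 + |u| / G := by
          have := div_le_div_of_nonneg_left (abs_nonneg u) hG hGT
          linarith
    have h3 : (u / G) ^ 2 = (|u| / G) ^ 2 := by rw [div_pow, div_pow, sq_abs]
    have h4 : -(1 / (2 * G ^ 2)) * u ^ 2 = -(1/2) * (|u| / G) ^ 2 := by
      rw [div_pow, sq_abs]; field_simp
    rw [h3, h4]
    nlinarith [sq_nonneg (|u| / G - 2)]
  have hc : 0 ≤ 1 / (Real.sqrt π * G) * ‖riemannZeta (zs (t + u))‖ ^ 4 := by positivity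
  have := mul_le_mul_of_nonneg_left key hc
  calc _ = 1 / (Real.sqrt π * G) * ‖riemannZeta (zs (t + u))‖ ^ 4 * Real.exp (-(u / G) ^ 2) := by ring
    _ ≤ _ := this
    _ = _ := by ring

lemma zq2_bdd (G : ℝ) (hG : 0 < G) (u : ℝ) : ‖zq2 G u‖ ≤ Real.exp 2 / (Real.sqrt π * G) := by
  have : 0 < Real.sqrt π := Real.sqrt_pos.2 Real.pi_pos
  unfold zq2
  rw [Real.norm_of_nonneg (by positivity)]
  refine mul_le_of_le_one_right (by positivity) (Real.exp_le_one_iff.2 ?_)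
  have : 0 ≤ 1 / (2 * G ^ 2) * u ^ 2 := by positivity
  linarith

lemma zq2_cont (G : ℝ) : Continuous (zq2 G) := by unfold zq2; fun_prop
lemma zw2_cont (G : ℝ) : Continuous (zw2 G) := by unfold zw2; fun_prop

lemma zJ_eq (t G : ℝ) : J 1 t G = ∫ u, zw2 G u * ‖riemannZeta (zs (t + u))‖ ^ 2 := by
  unfold J zw2
  rw [← integral_const_mul]
  refine integral_congr_ae (Filter.Eventually.of_forall fun u => ?_)
  simp only [zarg, mul_one]
  ring

lemma zw2_nonneg (G : ℝ) (hG : 0 < G) (u : ℝ) : 0 ≤ zw2 G u := by unfold zw2; positivity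

lemma zJ_bound (T G t : ℝ) (hT : 0 < T) (hG : 0 < G) (hGT : G ≤ T) (ht0 : 0 ≤ t) (ht : t ≤ 2 * T)
    (hi : Integrable (zG (1 / T))) :
    0 ≤ J 1 t G ∧ J 1 t G ^ 2 ≤ Real.exp 4 * ∫ u, zq2 G u * zG (1 / T) (t - u) := by
  have hZc : Continuous (fun u : ℝ => riemannZeta (zs (t + u))) := zzeta_cont.comp (by fun_prop : Continuous fun u : ℝ => t + u)
  have i0 : Integrable (fun u => zq2 G u * zG (1 / T) (t + u)) :=
    (hi.comp_add_left t).bdd_mul (zq2_cont G).aestronglyMeasurable (Filter.Eventually.of_forall (zq2_bdd G hG))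
  have i4 : Integrable (fun u => zw2 G u * ‖riemannZeta (zs (t + u))‖ ^ 4) := by
    refine (i0.const_mul (Real.exp 4)).mono' ((zw2_cont G).mul (hZc.norm.pow 4)).aestronglyMeasurable
      (Filter.Eventually.of_forall fun u => ?_)
    have := zw2_nonneg G hG u
    rw [Real.norm_of_nonneg (by positivity)]
    exact zpt T G t u hT hG hGT ht0 ht
  have iw := zw2_int G hG
  have i2 : Integrable (fun u => zw2 G u * ‖riemannZeta (zs (t + u))‖ ^ 2) := by
    refine (iw.add i4).mono' ((zw2_cont G).mul (hZc.norm.pow 2)).aestronglyMeasurable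
      (Filter.Eventually.of_forall fun u => ?_)
    have := zw2_nonneg G hG u
    rw [Real.norm_of_nonneg (by positivity), Pi.add_apply]
    nlinarith [mul_nonneg this (sq_nonneg (‖riemannZeta (zs (t + u))‖ ^ 2 - 1 / 2))]
  have hJ := zJ_eq t G
  have hJ0 : 0 ≤ J 1 t G := by
    rw [hJ]
    refine integral_nonneg fun u => ?_
    have := zw2_nonneg G hG u
    positivity
  refine ⟨hJ0, ?_⟩
  have hcs : J 1 t G ^ 2 ≤ ∫ u, zw2 G u * ‖riemannZeta (zs (t + u))‖ ^ 4 := by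
    set A := J 1 t G with hA
    have hs : (0:ℝ) ≤ ∫ u, (zw2 G u * ‖riemannZeta (zs (t + u))‖ ^ 4 - (2 * A) * (zw2 G u * ‖riemannZeta (zs (t + u))‖ ^ 2)
        + A ^ 2 * zw2 G u) := by
      refine integral_nonneg fun u => ?_
      have := mul_nonneg (zw2_nonneg G hG u) (sq_nonneg (‖riemannZeta (zs (t + u))‖ ^ 2 - A))
      simp only [Pi.zero_apply]
      nlinarith
    have ii : Integrable (fun u => zw2 G u * ‖riemannZeta (zs (t + u))‖ ^ 4 - (2 * A) * (zw2 G u * ‖riemannZeta (zs (t + u))‖ ^ 2)) :=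
      i4.sub (i2.const_mul _)
    rw [integral_add ii (iw.const_mul _), integral_sub i4 (i2.const_mul _), integral_const_mul, integral_const_mul,
      zw2_val G hG, ← hJ] at hs
    nlinarith
  refine hcs.trans ?_
  have e : ∫ u, zq2 G u * zG (1 / T) (t - u) = ∫ u, zq2 G u * zG (1 / T) (t + u) := by
    rw [← integral_neg_eq_self]
    refine integral_congr_ae (Filter.Eventually.of_forall fun u => ?_)
    simp only [zq2, neg_sq, sub_neg_eq_add]
  rw [e, ← integral_const_mul]
  exact integral_mono i4 (i0.const_mul _) fun u => zpt T G t u hT hG hGT ht0 ht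

open scoped Convolution in
lemma zconv (f g : ℝ → ℝ) (hf : Integrable f) (hg : Integrable g) :
    Integrable (fun t => ∫ u, f u * g (t - u)) ∧ ∫ t, ∫ u, f u * g (t - u) = (∫ u, f u) * ∫ u, g u := by
  constructor
  · exact hf.integrable_convolution (ContinuousLinearMap.mul ℝ ℝ) hg
  · exact integral_convolution (ContinuousLinearMap.mul ℝ ℝ) hf hg

lemma zfinal (B : ℝ → ℝ) (F : ℝ → ℝ) (T V : ℝ) (hT : 2 ≤ T) (hB : Integrable B) (hB0 : ∀ t, 0 ≤ B t)
    (hV : ∫ t, B t ≤ V) (c : ℝ) (hF0 : ∀ t, T ≤ t → t ≤ 2 * T → 0 ≤ F t)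
    (hF : ∀ t, T ≤ t → t ≤ 2 * T → F t ≤ c + B t) :
    ∫ t in T..(2 * T), F t ≤ c * T + V := by
  have hle : T ≤ 2 * T := by linarith
  have hcst : IntegrableOn (fun _ : ℝ => c) (Set.Ioc T (2 * T)) :=
    integrableOn_const (by simp) (by simp)
  rw [intervalIntegral.integral_of_le hle]
  have h1 : ∫ t in Set.Ioc T (2 * T), F t ≤ ∫ t in Set.Ioc T (2 * T), (c + B t) := by
    refine integral_mono_of_nonneg ?_ (hcst.add hB.integrableOn) ?_
    · exact (ae_restrict_iff' measurableSet_Ioc).2 (Filter.Eventually.of_forall fun t ht => hF0 t ht.1.le ht.2)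
    · exact (ae_restrict_iff' measurableSet_Ioc).2 (Filter.Eventually.of_forall fun t ht => hF t ht.1.le ht.2)
  refine h1.trans ?_
  rw [integral_add hcst hB.integrableOn]
  have h2 : ∫ t in Set.Ioc T (2 * T), B t ≤ ∫ t, B t :=
    setIntegral_le_integral hB (Filter.Eventually.of_forall hB0)
  have h3 : ∫ _ in Set.Ioc T (2 * T), c = c * T := by
    rw [setIntegral_const, Real.volume_real_Ioc_of_le hle, smul_eq_mul]; ring
  linarith

end PartTwelve

/-- For every `ε > 0`, `∫_T^{2T} J_1(t,G)^m dt ≪_ε T^{1+ε}` for `m = 1, 2`,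
uniformly for `T^ε ≤ G ≤ T`, `T ≥ 2`. -/
theorem moments_J1_first_second :
    ∀ ε : ℝ, 0 < ε → ∃ C : ℝ, 0 < C ∧ ∀ m : ℕ, (m = 1 ∨ m = 2) →
      ∀ T G : ℝ, 2 ≤ T → T ^ ε ≤ G → G ≤ T →
        (∫ t in T..(2 * T), J 1 t G ^ m) ≤ C * T ^ (1 + ε) := by
  intro ε hε
  obtain ⟨C, hC, h⟩ := zfourth (ε / 2) (by linarith)
  refine ⟨1 + Real.exp 4 * (2 * Real.exp 2 * C), by positivity, fun m hm T G hT hTG hGT => ?_⟩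
  have hT0 : 0 < T := by linarith
  have hG : 0 < G := lt_of_lt_of_le (Real.rpow_pos_of_pos hT0 ε) hTG
  have hδ : 1 / T ≤ π / 4 := by
    have : 1 / T ≤ 1 / 2 := one_div_le_one_div_of_le (by norm_num) hT
    linarith [Real.pi_gt_three]
  obtain ⟨hi, hv⟩ := h (1 / T) (by positivity) hδ
  have ep : (1 / T) ^ (-(1 + 2 * (ε / 2))) = T ^ (1 + ε) := by
    rw [one_div, Real.inv_rpow hT0.le, Real.rpow_neg hT0.le, inv_inv]; congr 1; ring
  rw [ep] at hv
  obtain ⟨c1, c2⟩ := zconv (zq2 G) (zG (1 / T)) (zq2_int G hG) hi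
  have hq0 : ∀ u, 0 ≤ zq2 G u := fun u => by unfold zq2; positivity
  have hg0 : ∀ u, 0 ≤ zG (1 / T) u := fun u => by unfold zG; positivity
  have hB := c1.const_mul (Real.exp 4)
  have hB0 : ∀ t, 0 ≤ Real.exp 4 * ∫ u, zq2 G u * zG (1 / T) (t - u) := fun t =>
    mul_nonneg (Real.exp_pos _).le (integral_nonneg fun u => mul_nonneg (hq0 u) (hg0 _))
  have hV : ∫ t, Real.exp 4 * ∫ u, zq2 G u * zG (1 / T) (t - u) ≤ Real.exp 4 * (2 * Real.exp 2 * (C * T ^ (1 + ε))) := by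
    rw [integral_const_mul, c2]
    refine mul_le_mul_of_nonneg_left ?_ (Real.exp_pos _).le
    exact mul_le_mul (zq2_val G hG) hv (integral_nonneg hg0) (by positivity)
  have hb : ∀ t, T ≤ t → t ≤ 2 * T → _ := fun t h1 h2 => zJ_bound T G t hT0 hG hGT (by linarith) h2 hi
  have hTT : T ≤ T ^ (1 + ε) := by
    calc T = T ^ (1:ℝ) := (Real.rpow_one T).symm
      _ ≤ T ^ (1 + ε) := Real.rpow_le_rpow_of_exponent_le (by linarith) (by linarith)
  have hfin := zfinal _ (fun t => J 1 t G ^ m) T _ hT hB hB0 hV 1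
    (fun t h1 h2 => pow_nonneg (hb t h1 h2).1 m) (fun t h1 h2 => by
      obtain ⟨a1, a2⟩ := hb t h1 h2
      rcases hm with rfl | rfl
      · simp only [pow_one]
        nlinarith [sq_nonneg (J 1 t G - 1 / 2)]
      · linarith)
  refine hfin.trans ?_
  nlinarith
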